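/- There exists a constant c > 0 (depending only on the lattice SL(2,ℤ) and the chosen norm) such that for every nonzero v ∈ ℝ² whose orbit {γ·v : γ ∈ SL(2,ℤ)} is not a discrete subset of ℝ², and every continuous compactly supported function φ : ℝ² \ {0} → ℝ, one has (1/T)·∑_{γ ∈ SL(2,ℤ), ‖γ‖ ≤ T} φ(γ·v) → (1/(c·|v|))·∫_{ℝ²\{0}} φ(w)/|w| dw as T → ∞. -/

import Mathlib

open Matrix MeasureTheory Filter Topology

noncomputable section

abbrev SL2Z := Matrix.SpecialLinearGroup (Fin 2) ℤ

/-- The real matrix associated to an element of `SL(2,ℤ)`. -/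
def toR (γ : SL2Z) : Matrix (Fin 2) (Fin 2) ℝ :=
  (γ : Matrix (Fin 2) (Fin 2) ℤ).map (Int.cast)

/-- The Euclidean plane. -/
abbrev E2 := EuclideanSpace ℝ (Fin 2)

/-- The vector of `ℝ²` with coordinates `a`, `b`. -/
def vec (a b : ℝ) : E2 := (WithLp.equiv 2 (Fin 2 → ℝ)).symm ![a, b]

/-- The action of `SL(2,ℤ)` on `ℝ²` by matrix-vector multiplication. -/
def act (γ : SL2Z) (v : E2) : E2 :=
  (WithLp.equiv 2 (Fin 2 → ℝ)).symm ((toR γ).mulVec (WithLp.equiv 2 (Fin 2 → ℝ) v))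

/-- The Frobenius (euclidean) norm of a 2×2 real matrix. -/
def frobNorm (A : Matrix (Fin 2) (Fin 2) ℝ) : ℝ := Real.sqrt (∑ i, ∑ j, (A i j) ^ 2)

/-- A vector of `ℝ²` is primitive if its coordinates are coprime integers. -/
def IsPrimitive (v : E2) : Prop := ∃ p q : ℤ, Int.gcd p q = 1 ∧ v 0 = p ∧ v 1 = q

/-- The set of points of rational slope and period `ρ`: points `v` such that `√ρ • v`
is primitive. -/
def P (ρ : ℝ) : Set E2 := {v | IsPrimitive (Real.sqrt ρ • v)}

/-- The spectrum of periods of `v`: the euclidean distance from `v` to `P ρ`. -/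
def Dv (v : E2) (ρ : ℝ) : ℝ := Metric.infDist v (P ρ)

/-- First coordinate (scalar product with `(x,y)`) of an integer vector. -/
def zf (x y : ℝ) (r : ℤ × ℤ) : ℝ := r.1 * x + r.2 * y
/-- Second coordinate (along the orthogonal direction) of an integer vector. -/
def sf (x y : ℝ) (r : ℤ × ℤ) : ℝ := r.2 * x - r.1 * y
/-- Irrationality of the direction `(x,y)`. -/
def Irr (x y : ℝ) : Prop := ∀ a b : ℤ, (a : ℝ) * x + b * y = 0 → a = 0 ∧ b = 0

lemma Irr.x_ne {x y : ℝ} (h : Irr x y) : x ≠ 0 := by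
  rintro rfl
  have := h 1 0 (by simp)
  simp at this

lemma Irr.y_ne {x y : ℝ} (h : Irr x y) : y ≠ 0 := by
  rintro rfl
  have := h 0 1 (by simp)
  simp at this

lemma Irr.q_pos {x y : ℝ} (h : Irr x y) : 0 < x ^ 2 + y ^ 2 := by
  have := sq_pos_of_ne_zero h.x_ne
  positivity

lemma zf_add (x y : ℝ) (r r' : ℤ × ℤ) : zf x y (r + r') = zf x y r + zf x y r' := by
  simp [zf]; ring

lemma sf_add (x y : ℝ) (r r' : ℤ × ℤ) : sf x y (r + r') = sf x y r + sf x y r' := by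
  simp [sf]; ring

lemma zf_ne {x y : ℝ} (h : Irr x y) {r : ℤ × ℤ} (hr : r ≠ 0) : zf x y r ≠ 0 := by
  intro h0
  have := h r.1 r.2 h0
  exact hr (Prod.ext this.1 this.2)

lemma box_count {x y : ℝ} (h : Irr x y) (A B : ℝ) (hA : 0 ≤ A) (hB : 0 ≤ B) :
    ∃ C : ℝ, 0 < C ∧ ∀ T : ℝ, 1 ≤ T → ∃ R : Finset (ℤ × ℤ),
      (∀ r, |zf x y r| ≤ A → |sf x y r| ≤ B * T → r ∈ R) ∧ (R.card : ℝ) ≤ C * T := by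
  have hy := abs_pos.2 h.y_ne
  have hq := h.q_pos
  set q := x ^ 2 + y ^ 2 with hqdef
  set c1 := (|x| * A + |y| * B) / q with hc1
  have hc1' : 0 ≤ c1 := by positivity
  refine ⟨(2 * c1 + 1) * (2 * (A / |y|) + 1), by positivity, fun T hT => ?_⟩
  let I : Finset ℤ := Finset.Icc (-⌊c1 * T⌋) ⌊c1 * T⌋
  let J : ℤ → Finset ℤ := fun a => Finset.Icc ⌈-(a * x / y) - A / |y|⌉ ⌊-(a * x / y) + A / |y|⌋
  refine ⟨I.biUnion (fun a => (J a).image (fun b => (a, b))), ?_, ?_⟩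
  · rintro ⟨a, b⟩ hz hs
    simp only [Finset.mem_biUnion, Finset.mem_image, Prod.mk.injEq]
    refine ⟨a, ?_, b, ?_, rfl, rfl⟩
    · have hab : |(a : ℝ)| ≤ c1 * T := by
        have e : (a : ℝ) * q = x * zf x y (a, b) - y * sf x y (a, b) := by
          simp [zf, sf, hqdef]; ring
        have : |(a : ℝ)| * q ≤ |x| * A + |y| * (B * T) := by
          rw [show |(a : ℝ)| * q = |(a : ℝ) * q| by rw [abs_mul, abs_of_pos hq], e]
          calc _ ≤ |x * zf x y (a, b)| + |y * sf x y (a, b)| := abs_sub _ _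
            _ ≤ _ := by rw [abs_mul, abs_mul]; gcongr
        have h2 : |x| * A + |y| * (B * T) ≤ (|x| * A + |y| * B) * T := by
          nlinarith [mul_nonneg (abs_nonneg x) hA]
        rw [hc1, div_mul_eq_mul_div, le_div_iff₀ hq]
        linarith
      rw [abs_le] at hab
      simp only [I, Finset.mem_Icc]
      constructor
      · rw [neg_le, Int.le_floor]; push_cast; linarith
      · rw [Int.le_floor]; exact hab.2
    · have e : (b : ℝ) + a * x / y = zf x y (a, b) / y := by
        have := h.y_ne
        simp [zf]; field_simp; ring
      have : |(b : ℝ) + a * x / y| ≤ A / |y| := by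
        rw [e, abs_div]; gcongr
      rw [abs_le] at this
      simp only [J, Finset.mem_Icc]
      constructor
      · rw [Int.ceil_le]; linarith
      · rw [Int.le_floor]; linarith
  · have hJ : ∀ a, ((J a).card : ℝ) ≤ 2 * (A / |y|) + 1 := by
      intro a
      simp only [J, Int.card_Icc]
      have hAy : 0 ≤ A / |y| := by positivity
      rw [← Int.cast_natCast, Int.toNat_eq_max]
      push_cast
      apply max_le
      · have := Int.floor_le (-(a * x / y) + A / |y|)
        have := Int.le_ceil (-(a * x / y) - A / |y|)
        linarith
      · linarith
    have hI : ((I.card : ℕ) : ℝ) ≤ 2 * (c1 * T) + 1 := by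
      simp only [I, Int.card_Icc]
      rw [← Int.cast_natCast, Int.toNat_eq_max]
      have : 0 ≤ c1 * T := by positivity
      push_cast
      apply max_le
      · have := Int.floor_le (c1 * T)
        linarith
      · linarith
    calc ((I.biUnion (fun a => (J a).image (fun b => (a, b)))).card : ℝ)
        ≤ ∑ a ∈ I, (((J a).image (fun b => (a, b))).card : ℝ) := by
          exact_mod_cast Finset.card_biUnion_le
      _ ≤ ∑ a ∈ I, (2 * (A / |y|) + 1) := by
          apply Finset.sum_le_sum
          intro a _
          refine le_trans ?_ (hJ a)
          exact_mod_cast Finset.card_image_le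
      _ = I.card * (2 * (A / |y|) + 1) := by rw [Finset.sum_const, nsmul_eq_mul]
      _ ≤ (2 * (c1 * T) + 1) * (2 * (A / |y|) + 1) := by gcongr
      _ ≤ (2 * c1 + 1) * (2 * (A / |y|) + 1) * T := by
          have hAy : 0 ≤ 2 * (A / |y|) + 1 := by positivity
          nlinarith

/-- A function vanishing outside a box. -/
def BoxSupp (F : ℝ × ℝ → ℝ) (A B : ℝ) : Prop := ∀ p, F p ≠ 0 → |p.1| ≤ A ∧ |p.2| ≤ B

lemma BoxSupp.hasCompactSupport {F : ℝ × ℝ → ℝ} {A B : ℝ} (h : BoxSupp F A B) :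
    HasCompactSupport F := by
  apply HasCompactSupport.intro (K := Set.Icc (-A) A ×ˢ Set.Icc (-B) B)
    (isCompact_Icc.prod isCompact_Icc)
  intro p hp
  by_contra h0
  have := h p h0
  rw [abs_le, abs_le] at this
  exact hp ⟨this.1, this.2⟩

lemma BoxSupp.uc {F : ℝ × ℝ → ℝ} {A B : ℝ} (h : BoxSupp F A B) (hF : Continuous F) :
    ∀ ε > 0, ∃ δ > 0, ∀ a b c d : ℝ, |a - c| < δ → |b - d| < δ → |F (a, b) - F (c, d)| < ε := by
  have := h.hasCompactSupport.uniformContinuous_of_continuous hF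
  rw [Metric.uniformContinuous_iff] at this
  intro ε hε
  obtain ⟨δ, hδ, H⟩ := this ε hε
  refine ⟨δ, hδ, fun a b c d h1 h2 => ?_⟩
  have := @H (a, b) (c, d) (by rw [Prod.dist_eq]; exact max_lt h1 h2)
  exact this

lemma BoxSupp.bdd {F : ℝ × ℝ → ℝ} {A B : ℝ} (h : BoxSupp F A B) (hF : Continuous F) :
    ∃ M : ℝ, 0 < M ∧ ∀ p, |F p| ≤ M := by
  obtain ⟨M, hM⟩ := h.hasCompactSupport.exists_bound_of_continuous hF
  exact ⟨max M 1, by positivity, fun p => (hM p).trans (le_max_left _ _)⟩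

lemma zf_dense {x y : ℝ} (h : Irr x y) (t : ℝ) {δ : ℝ} (hδ : 0 < δ) :
    ∃ r : ℤ × ℤ, |zf x y r - t| < δ := by
  have hirr : Irrational (x / y) := by
    rintro ⟨p, hp⟩
    have hy := h.y_ne
    have hd : (p.den : ℝ) ≠ 0 := by exact_mod_cast p.den_nz
    have : (p.den : ℤ) = 0 ∧ (-p.num) = 0 := by
      apply h
      have e : (p : ℝ) = p.num / p.den := Rat.cast_def p
      rw [e] at hp
      field_simp at hp
      push_cast
      linarith
    exact p.den_nz (by exact_mod_cast this.1)
  have hd := dense_addSubgroupClosure_pair_iff.2 hirr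
  obtain ⟨g, hg1, hg2⟩ := Metric.dense_iff.1 hd t δ hδ
  have := AddSubgroup.mem_closure_pair.1 hg2
  obtain ⟨m, n, hmn⟩ := this
  refine ⟨(m, n), ?_⟩
  have e : zf x y (m, n) = g := by rw [← hmn]; simp [zf]
  rw [e]
  exact hg1

lemma tsum_abs_le_card {ι : Type*} {f : ι → ℝ} (R : Finset ι) (hR : ∀ i, f i ≠ 0 → i ∈ R)
    {ω : ℝ} (hf : ∀ i, |f i| ≤ ω) : |∑' i, f i| ≤ ω * R.card := by
  rw [tsum_eq_sum (s := R) (fun i hi => by by_contra h; exact hi (hR i h))]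
  calc _ ≤ ∑ i ∈ R, |f i| := Finset.abs_sum_le_sum_abs _ _
    _ ≤ ∑ i ∈ R, ω := Finset.sum_le_sum fun i _ => hf i
    _ = _ := by rw [Finset.sum_const, nsmul_eq_mul, mul_comm]

lemma shift_mem {x y : ℝ} {F : ℝ × ℝ → ℝ} {A B : ℝ} (hS : BoxSupp F A B) {ζ σ : ℝ}
    {T W V : ℝ} (hT : 1 ≤ T) (hζ : |ζ| ≤ W) (hσ : |σ| ≤ V * T) (r : ℤ × ℤ)
    (h : F (zf x y r + ζ, (sf x y r + σ) / T) ≠ 0) :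
    |zf x y r| ≤ A + W ∧ |sf x y r| ≤ (B + V) * T := by
  have hT0 : 0 < T := by linarith
  obtain ⟨h1, h2⟩ := hS _ h
  simp only at h1 h2
  rw [abs_div, abs_of_pos hT0, div_le_iff₀ hT0] at h2
  constructor
  · have := abs_sub (zf x y r + ζ) ζ
    rw [add_sub_cancel_right] at this
    linarith
  · have := abs_sub (sf x y r + σ) σ
    rw [add_sub_cancel_right] at this
    linarith

lemma shift_diff {x y : ℝ} (h : Irr x y) {F : ℝ × ℝ → ℝ} {A B : ℝ} (hA : 0 ≤ A) (hB : 0 ≤ B)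
    (hF : Continuous F) (hS : BoxSupp F A B) (ζ σ : ℝ) :
    Tendsto (fun T : ℝ => (1 / T) * (∑' r, F (zf x y r, sf x y r / T)
      - ∑' r, F (zf x y r + ζ, (sf x y r + σ) / T))) atTop (𝓝 0) := by
  rw [Metric.tendsto_nhds]
  intro ε hε
  obtain ⟨C, hC, HC⟩ := box_count h (A + (|ζ| + 1)) (B + (|σ| + 1)) (by positivity) (by positivity)
  obtain ⟨δ, hδ, Hδ⟩ := hS.uc hF (ε / (2 * C)) (by positivity)
  obtain ⟨r0, hr0⟩ := zf_dense h ζ (lt_min hδ one_pos)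
  filter_upwards [eventually_ge_atTop 1, eventually_gt_atTop (|sf x y r0 - σ| / (min δ 1))] with T hT hT2
  have hT0 : 0 < T := by linarith
  have hm : 0 < min δ 1 := lt_min hδ one_pos
  have hst : |sf x y r0 - σ| < (min δ 1) * T := by
    rw [div_lt_iff₀ hm] at hT2; linarith
  obtain ⟨R, hR, hcard⟩ := HC T hT
  have e1 : ∑' r, F (zf x y r, sf x y r / T)
      = ∑' r, F (zf x y r + zf x y r0, (sf x y r + sf x y r0) / T) := by
    rw [← (Equiv.addRight r0).tsum_eq]
    simp [zf_add, sf_add]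
  have m1 : ∀ r, F (zf x y r + zf x y r0, (sf x y r + sf x y r0) / T) ≠ 0 → r ∈ R := by
    intro r hr
    have k1 : |zf x y r0| ≤ |ζ| + 1 := by
      have := abs_add_le ζ (zf x y r0 - ζ)
      have := hr0.trans_le (min_le_right _ _)
      rw [add_sub_cancel] at *
      linarith
    have k2 : |sf x y r0| ≤ (|σ| + 1) * T := by
      have := abs_add_le σ (sf x y r0 - σ)
      rw [add_sub_cancel] at *
      have : (min δ 1) * T ≤ 1 * T := by gcongr; exact min_le_right _ _
      nlinarith [abs_nonneg σ]
    have := shift_mem hS hT k1 k2 r hr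
    exact hR r this.1 this.2
  have m2 : ∀ r, F (zf x y r + ζ, (sf x y r + σ) / T) ≠ 0 → r ∈ R := by
    intro r hr
    have := shift_mem (W := |ζ| + 1) (V := |σ| + 1) hS hT (by linarith)
      (by nlinarith [abs_nonneg σ]) r hr
    exact hR r this.1 this.2
  have s1 : ∀ f : ℤ × ℤ → ℝ, (∀ r, f r ≠ 0 → r ∈ R) → Summable f := fun f hf =>
    summable_of_ne_finset_zero (s := R) (fun i hi => by by_contra h; exact hi (hf i h))
  rw [e1, ← (s1 _ m1).tsum_sub (s1 _ m2)]
  have b := tsum_abs_le_card (f := fun r => F (zf x y r + zf x y r0, (sf x y r + sf x y r0) / T)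
    - F (zf x y r + ζ, (sf x y r + σ) / T)) R (by
      intro r hr
      by_contra hn
      apply hr
      have a1 : F (zf x y r + zf x y r0, (sf x y r + sf x y r0) / T) = 0 := by
        by_contra h; exact hn (m1 r h)
      have a2 : F (zf x y r + ζ, (sf x y r + σ) / T) = 0 := by
        by_contra h; exact hn (m2 r h)
      simp only [a1, a2, sub_zero]) (ω := ε / (2 * C)) (by
      intro r
      apply le_of_lt
      apply Hδ
      · rw [add_sub_add_left_eq_sub]; exact hr0.trans_le (min_le_left _ _)
      · rw [← sub_div, add_sub_add_left_eq_sub, abs_div, abs_of_pos hT0, div_lt_iff₀ hT0]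
        refine hst.trans_le ?_
        gcongr; exact min_le_left _ _)
  rw [Real.dist_eq, sub_zero, abs_mul, abs_of_pos (by positivity : 0 < 1 / T)]
  calc _ ≤ 1 / T * (ε / (2 * C) * R.card) := by gcongr
    _ ≤ 1 / T * (ε / (2 * C) * (C * T)) := by gcongr
    _ = ε / 2 := by field_simp
    _ < ε := by linarith

lemma integral_lattice_scale {x y : ℝ} (h : Irr x y) (F : ℝ × ℝ → ℝ) {T : ℝ} (hT : 0 < T) :
    ∫ p : ℝ × ℝ, F (p.1 * x + p.2 * y, (p.2 * x - p.1 * y) / T)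
      = T * (1 / (x ^ 2 + y ^ 2)) * ∫ p, F p := by
  have hq := h.q_pos
  let f : (ℝ × ℝ) →ₗ[ℝ] (ℝ × ℝ) :=
    { toFun := fun p => (p.1 * x + p.2 * y, (p.2 * x - p.1 * y) / T)
      map_add' := by intro p p'; ext <;> simp <;> ring
      map_smul' := by intro c p; ext <;> simp <;> ring }
  have hdet : LinearMap.det f = (x ^ 2 + y ^ 2) / T := by
    rw [← LinearMap.det_toMatrix (Module.Basis.finTwoProd ℝ), Matrix.det_fin_two]
    simp [LinearMap.toMatrix_apply, f]
    field_simp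
    ring
  have hne : LinearMap.det f ≠ 0 := by rw [hdet]; positivity
  have hmap := Measure.map_linearMap_addHaar_eq_smul_addHaar (volume : Measure (ℝ × ℝ)) hne
  have he : MeasurableEmbedding f :=
    (LinearEquiv.ofIsUnitDet (f := f) (v := Module.Basis.finTwoProd ℝ)
      (v' := Module.Basis.finTwoProd ℝ)
      (by rw [LinearMap.det_toMatrix]; exact isUnit_iff_ne_zero.2 hne)).toContinuousLinearEquiv.toHomeomorph.measurableEmbedding
  have := he.integral_map (μ := volume) F
  rw [hmap, integral_smul_measure, hdet, abs_of_pos (by positivity), ENNReal.toReal_ofReal (by positivity)] at this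
  rw [show (T * (1 / (x ^ 2 + y ^ 2))) = ((x ^ 2 + y ^ 2) / T)⁻¹ by field_simp]
  rw [smul_eq_mul] at this
  rw [this]
  rfl

/-- The unit square. -/
def Usq : Set (ℝ × ℝ) := Set.Ico 0 1 ×ˢ Set.Ico 0 1

lemma integral_tile {G : ℝ × ℝ → ℝ} (hG : Integrable G) :
    ∫ p, G p = ∑' r : ℤ × ℤ, ∫ u in Usq, G (u.1 + r.1, u.2 + r.2) := by
  let s : ℤ × ℤ → Set (ℝ × ℝ) := fun r => (fun p : ℝ × ℝ => (p.1 - r.1, p.2 - r.2)) ⁻¹' Usq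
  have hU : MeasurableSet Usq := measurableSet_Ico.prod measurableSet_Ico
  have hs : ∀ r, MeasurableSet (s r) := fun r => by
    apply Measurable.comp (g := id) measurable_id _ |> fun h : Measurable (fun p : ℝ × ℝ => (p.1 - (r.1 : ℝ), p.2 - (r.2 : ℝ))) => h hU
    fun_prop
  have hfl : ∀ (t : ℝ) (n : ℤ), t - n ∈ Set.Ico (0 : ℝ) 1 ↔ n = ⌊t⌋ := by
    intro t n
    rw [eq_comm, Int.floor_eq_iff, Set.mem_Ico]
    constructor <;> rintro ⟨h1, h2⟩ <;> constructor <;> linarith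
  have hmem : ∀ p r, p ∈ s r ↔ r = (⌊p.1⌋, ⌊p.2⌋) := by
    intro p r
    simp only [s, Usq, Set.mem_preimage, Set.mem_prod, hfl, Prod.ext_iff]
  have hun : ⋃ r, s r = Set.univ := by
    ext p; simp [hmem]
  have hd : Pairwise (Function.onFun Disjoint s) := by
    intro r r' hrr
    rw [Function.onFun, Set.disjoint_left]
    intro p h1 h2
    rw [hmem] at h1 h2
    exact hrr (h1.trans h2.symm)
  have := integral_iUnion (μ := volume) (f := G) hs hd (by rw [hun]; exact hG.integrableOn)
  rw [hun, setIntegral_univ] at this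
  rw [this]
  congr 1
  ext r
  have mp : MeasurePreserving (fun p : ℝ × ℝ => p + ((r.1 : ℝ), (r.2 : ℝ))) volume volume :=
    measurePreserving_add_right volume _
  have me : MeasurableEmbedding (fun p : ℝ × ℝ => p + ((r.1 : ℝ), (r.2 : ℝ))) :=
    measurableEmbedding_addRight _
  have := mp.setIntegral_preimage_emb me G (s r)
  rw [← this]
  have e : (fun p : ℝ × ℝ => p + ((r.1 : ℝ), (r.2 : ℝ))) ⁻¹' (s r) = Usq := by
    ext p; simp [s]
  rw [e]
  rfl

/-- All integer points equidistribute in strips around an irrational direction. -/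
lemma lattice_equi {x y : ℝ} (h : Irr x y) {F : ℝ × ℝ → ℝ} {A B : ℝ} (hA : 0 ≤ A) (hB : 0 ≤ B)
    (hF : Continuous F) (hS : BoxSupp F A B) :
    Tendsto (fun T : ℝ => (1 / T) * ∑' r, F (zf x y r, sf x y r / T)) atTop
      (𝓝 ((1 / (x ^ 2 + y ^ 2)) * ∫ p, F p)) := by
  set W := |x| + |y| with hW
  have hW0 : 0 ≤ W := by positivity
  let zr : ℝ × ℝ → ℝ := fun u => u.1 * x + u.2 * y
  let sr : ℝ × ℝ → ℝ := fun u => u.2 * x - u.1 * y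
  have hu : ∀ u ∈ Usq, |u.1| ≤ 1 ∧ |u.2| ≤ 1 := by
    rintro ⟨a, b⟩ ⟨⟨h1, h2⟩, ⟨h3, h4⟩⟩
    simp only at *
    rw [abs_of_nonneg h1, abs_of_nonneg h3]
    constructor <;> linarith
  have hzr : ∀ u ∈ Usq, |zr u| ≤ W := by
    intro u hu'
    obtain ⟨h1, h2⟩ := hu u hu'
    calc |zr u| ≤ |u.1 * x| + |u.2 * y| := abs_add_le _ _
      _ ≤ 1 * |x| + 1 * |y| := by rw [abs_mul, abs_mul]; gcongr
      _ = W := by rw [hW]; ring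
  have hsr : ∀ u ∈ Usq, |sr u| ≤ W := by
    intro u hu'
    obtain ⟨h1, h2⟩ := hu u hu'
    calc |sr u| ≤ |u.2 * x| + |u.1 * y| := abs_sub _ _
      _ ≤ 1 * |x| + 1 * |y| := by rw [abs_mul, abs_mul]; gcongr
      _ = W := by rw [hW]; ring
  have hU : MeasurableSet Usq := measurableSet_Ico.prod measurableSet_Ico
  have hvol : volume Usq = 1 := by
    rw [Usq, Measure.volume_eq_prod, Measure.prod_prod]; simp
  obtain ⟨C, hC, HC⟩ := box_count h (A + W) (B + W) (by positivity) (by positivity)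
  obtain ⟨M, hM, HM⟩ := hS.bdd hF
  -- the difference function
  let D : ℝ → ℝ × ℝ → ℝ := fun T u => (1 / T) * (∑' r, F (zf x y r, sf x y r / T)
      - ∑' r, F (zf x y r + zr u, (sf x y r + sr u) / T))
  have hmem : ∀ T, 1 ≤ T → ∀ R : Finset (ℤ × ℤ),
      (∀ r, |zf x y r| ≤ A + W → |sf x y r| ≤ (B + W) * T → r ∈ R) → 
      ∀ u ∈ Usq, ∀ r, F (zf x y r + zr u, (sf x y r + sr u) / T) ≠ 0 → r ∈ R := by
    intro T hT R hR u hu' r hr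
    have := shift_mem (W := W) (V := W) hS hT (hzr u hu') ((hsr u hu').trans (by nlinarith)) r hr
    exact hR r this.1 this.2
  have h0 : ((0 : ℝ), (0 : ℝ)) ∈ Usq := by simp [Usq]
  have hz0 : zr (0, 0) = 0 := by simp [zr]
  have hs0 : sr (0, 0) = 0 := by simp [sr]
  have key : ∀ T, 1 ≤ T → (1 / T) * ∑' r, F (zf x y r, sf x y r / T)
      = (1 / (x ^ 2 + y ^ 2)) * (∫ p, F p) + ∫ u in Usq, D T u := by
    intro T hT
    have hT0 : 0 < T := by linarith
    obtain ⟨R, hR, hcard⟩ := HC T hT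
    have hm := hmem T hT R hR
    have hintg : Integrable (fun p : ℝ × ℝ => F (p.1 * x + p.2 * y, (p.2 * x - p.1 * y) / T)) := by
      apply Continuous.integrable_of_hasCompactSupport (by fun_prop)
      have hq := h.q_pos
      set q := x ^ 2 + y ^ 2 with hqd
      apply BoxSupp.hasCompactSupport (A := (|x| * A + |y| * (B * T)) / q)
        (B := (|y| * A + |x| * (B * T)) / q)
      intro p hp
      obtain ⟨h1, h2⟩ := hS _ hp
      simp only at h1 h2
      rw [abs_div, abs_of_pos hT0, div_le_iff₀ hT0] at h2
      constructor
      · rw [le_div_iff₀ hq, ← abs_of_pos hq, ← abs_mul]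
        rw [show p.1 * q = x * (p.1 * x + p.2 * y) - y * (p.2 * x - p.1 * y) by rw [hqd]; ring]
        refine (abs_sub _ _).trans ?_
        rw [abs_mul, abs_mul]; gcongr
      · rw [le_div_iff₀ hq, ← abs_of_pos hq, ← abs_mul]
        rw [show p.2 * q = y * (p.1 * x + p.2 * y) + x * (p.2 * x - p.1 * y) by rw [hqd]; ring]
        refine (abs_add_le _ _).trans ?_
        rw [abs_mul, abs_mul]; gcongr
    have e1 := integral_lattice_scale h F hT0
    rw [integral_tile hintg] at e1
    have e2 : ∀ r : ℤ × ℤ, (fun u : ℝ × ℝ => F ((u.1 + r.1) * x + (u.2 + r.2) * y,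
        ((u.2 + r.2) * x - (u.1 + r.1) * y) / T))
        = fun u => F (zf x y r + zr u, (sf x y r + sr u) / T) := by
      intro r; ext u; simp only [zf, sf, zr, sr]; congr 2 <;> ring
    simp only [e2] at e1
    rw [tsum_eq_sum (s := R) (by
      intro r hr
      rw [setIntegral_congr_fun (g := fun _ => (0 : ℝ)) hU]
      · simp
      · intro u hu'
        by_contra hne
        exact hr (hm u hu' r hne))] at e1
    have hio : ∀ f : ℝ × ℝ → ℝ, Continuous f → (∀ p, |f p| ≤ M) → IntegrableOn f Usq := by
      intro f hf hb
      apply Measure.integrableOn_of_bounded (M := M) (by rw [hvol]; simp)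
        hf.aestronglyMeasurable
      exact Eventually.of_forall hb
    have hcr : ∀ r : ℤ × ℤ, Continuous fun u : ℝ × ℝ => F (zf x y r + zr u, (sf x y r + sr u) / T) := by
      intro r; simp only [zr, sr]; fun_prop
    rw [← integral_finsetSum _ (fun r _ => hio _ (hcr r) (fun p => HM _))] at e1
    have e3 : ∀ u ∈ Usq, D T u = (1 / T) * ∑' r, F (zf x y r, sf x y r / T)
        - (1 / T) * ∑ r ∈ R, F (zf x y r + zr u, (sf x y r + sr u) / T) := by
      intro u hu'
      simp only [D]
      rw [mul_sub, tsum_eq_sum (f := fun r => F (zf x y r + zr u, (sf x y r + sr u) / T)) (s := R)]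
      intro r hr
      by_contra hne
      exact hr (hm u hu' r hne)
    rw [setIntegral_congr_fun hU e3, integral_sub, integral_const_mul (1 / T) (fun u => ∑ r ∈ R, F (zf x y r + zr u, (sf x y r + sr u) / T)), e1]
    · simp [measureReal_def, hvol]
      field_simp
      ring
    · exact integrableOn_const (by rw [hvol]; simp) enorm_ne_top
    · apply Integrable.const_mul
      exact integrable_finsetSum _ (fun r _ => hio _ (hcr r) (fun p => HM _))
  have hD : Tendsto (fun T => ∫ u in Usq, D T u) atTop (𝓝 (∫ u in Usq, (0 : ℝ))) := by
    apply tendsto_integral_filter_of_dominated_convergence (fun _ => M * C + M * C)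
    · filter_upwards [eventually_ge_atTop 1] with T hT
      obtain ⟨R, hR, hcard⟩ := HC T hT
      have hm := hmem T hT R hR
      have : AEStronglyMeasurable (fun u => (1 / T) * ∑' r, F (zf x y r, sf x y r / T)
        - (1 / T) * ∑ r ∈ R, F (zf x y r + zr u, (sf x y r + sr u) / T)) (volume.restrict Usq) := by
        apply Continuous.aestronglyMeasurable
        simp only [zr, sr]
        fun_prop
      apply this.congr
      filter_upwards [ae_restrict_mem hU] with u hu'
      simp only [D]
      rw [mul_sub, tsum_eq_sum (f := fun r => F (zf x y r + zr u, (sf x y r + sr u) / T)) (s := R)]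
      intro r hr
      by_contra hne
      exact hr (hm u hu' r hne)
    · filter_upwards [eventually_ge_atTop 1] with T hT
      filter_upwards [ae_restrict_mem hU] with u hu'
      have hT0 : 0 < T := by linarith
      obtain ⟨R, hR, hcard⟩ := HC T hT
      have b1 := tsum_abs_le_card (f := fun r => F (zf x y r, sf x y r / T)) R
        (fun r hr => hmem T hT R hR _ h0 r (by rw [hz0, hs0, add_zero, add_zero]; exact hr))
        (fun r => HM _)
      have b2 := tsum_abs_le_card (f := fun r => F (zf x y r + zr u, (sf x y r + sr u) / T)) R
        (hmem T hT R hR u hu') (fun r => HM _)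
      simp only [D]
      rw [Real.norm_eq_abs, abs_mul, abs_of_pos (by positivity : 0 < 1 / T)]
      calc _ ≤ 1 / T * (M * R.card + M * R.card) := by
            gcongr
            exact (abs_sub _ _).trans (add_le_add b1 b2)
        _ ≤ 1 / T * (M * (C * T) + M * (C * T)) := by gcongr
        _ = M * C + M * C := by field_simp
    · exact integrableOn_const (by rw [hvol]; simp) enorm_ne_top
    · refine Eventually.of_forall fun u => ?_
      exact shift_diff h hA hB hF hS (zr u) (sr u)
  rw [integral_zero] at hD
  have := hD.const_add ((1 / (x ^ 2 + y ^ 2)) * ∫ p, F p)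
  rw [add_zero] at this
  refine this.congr' ?_
  filter_upwards [eventually_ge_atTop 1] with T hT
  exact (key T hT).symm

/-- gcd of the coordinates. -/
def gc (r : ℤ × ℤ) : ℕ := Int.gcd r.1 r.2

lemma zf_smul (x y : ℝ) (d : ℕ) (r : ℤ × ℤ) : zf x y ((d : ℤ) * r.1, (d : ℤ) * r.2) = d * zf x y r := by
  simp [zf]; ring
lemma sf_smul (x y : ℝ) (d : ℕ) (r : ℤ × ℤ) : sf x y ((d : ℤ) * r.1, (d : ℤ) * r.2) = d * sf x y r := by
  simp [sf]; ring

lemma div_equi {x y : ℝ} (h : Irr x y) {F : ℝ × ℝ → ℝ} {A B : ℝ} (hA : 0 ≤ A) (hB : 0 ≤ B)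
    (hF : Continuous F) (hS : BoxSupp F A B) (d : ℕ) (hd : 0 < d) :
    Tendsto (fun T : ℝ => (1 / T) * ∑' r, (if d ∣ gc r then F (zf x y r, sf x y r / T) else 0)) atTop
      (𝓝 ((1 / (x ^ 2 + y ^ 2)) * (((d : ℝ) ^ 2)⁻¹ * ∫ p, F p))) := by
  have hd1 : (1 : ℝ) ≤ d := by exact_mod_cast hd
  have hS' : BoxSupp (fun p => F ((d : ℝ) • p)) A B := by
    intro p hp
    obtain ⟨h1, h2⟩ := hS _ hp
    simp only [Prod.smul_fst, Prod.smul_snd, smul_eq_mul, abs_mul, Nat.abs_cast] at h1 h2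
    constructor <;> nlinarith [abs_nonneg p.1, abs_nonneg p.2]
  have key := lattice_equi h hA hB (F := fun p => F ((d : ℝ) • p)) (by fun_prop) hS'
  rw [Measure.integral_comp_smul] at key
  simp only [Module.finrank_prod, Module.finrank_self, Nat.reduceAdd, smul_eq_mul, abs_inv, abs_pow,
    Nat.abs_cast] at key
  refine key.congr fun T => ?_
  congr 1
  let i : ℤ × ℤ → ℤ × ℤ := fun r => ((d : ℤ) * r.1, (d : ℤ) * r.2)
  have hi : Function.Injective i := by
    intro r r' hr
    have hd' : (d : ℤ) ≠ 0 := by exact_mod_cast hd.ne'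
    simp only [i, Prod.mk.injEq, mul_eq_mul_left_iff, hd', or_false] at hr
    exact Prod.ext hr.1 hr.2
  rw [← hi.tsum_eq (f := fun r => if d ∣ gc r then F (zf x y r, sf x y r / T) else 0)]
  · congr 1
    ext r
    have : d ∣ gc (i r) := by
      simp only [gc, i]
      rw [Int.gcd_mul_left]; simp
    rw [if_pos this]
    simp only [i, zf_smul, sf_smul, Prod.smul_mk, smul_eq_mul, mul_div_assoc]
  · intro r hr
    have hdv : d ∣ gc r := by
      by_contra hn
      simp [hn] at hr
    have h1 : (d : ℤ) ∣ r.1 := (Int.natCast_dvd_natCast.2 hdv).trans (Int.gcd_dvd_left ..)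
    have h2 : (d : ℤ) ∣ r.2 := (Int.natCast_dvd_natCast.2 hdv).trans (Int.gcd_dvd_right ..)
    obtain ⟨a, ha⟩ := h1
    obtain ⟨b, hb⟩ := h2
    exact ⟨(a, b), Prod.ext ha.symm hb.symm⟩

lemma sieve_id (g N : ℕ) (hN : N ≠ 0) :
    (∑ d ∈ N.divisors, if d ∣ g then (ArithmeticFunction.moebius d : ℝ) else 0)
      = if Nat.Coprime g N then 1 else 0 := by
  rw [← Finset.sum_filter]
  have e : N.divisors.filter (fun d => d ∣ g) = (Nat.gcd g N).divisors := by
    ext d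
    simp only [Finset.mem_filter, Nat.mem_divisors, Nat.dvd_gcd_iff]
    have : Nat.gcd g N ≠ 0 := by
      intro h0; exact hN (Nat.eq_zero_of_gcd_eq_zero_right h0)
    tauto
  rw [e]
  have := ArithmeticFunction.coe_mul_zeta_apply (f := ArithmeticFunction.moebius) (x := Nat.gcd g N)
  rw [ArithmeticFunction.moebius_mul_coe_zeta, ArithmeticFunction.one_apply] at this
  rw [← Int.cast_sum, ← this]
  simp [Nat.Coprime]

lemma finite_summable_aux {x y : ℝ} (h : Irr x y) {F : ℝ × ℝ → ℝ} {A B : ℝ} (hA : 0 ≤ A)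
    (hB : 0 ≤ B) (hS : BoxSupp F A B) (T : ℝ) (hT : 1 ≤ T) (f : ℤ × ℤ → ℝ)
    (hf : ∀ r, f r ≠ 0 → F (zf x y r, sf x y r / T) ≠ 0) : Summable f := by
  obtain ⟨C, hC, HC⟩ := box_count h A B hA hB
  obtain ⟨R, hR, -⟩ := HC T hT
  apply summable_of_ne_finset_zero (s := R)
  intro r hr
  by_contra hn
  apply hr
  obtain ⟨h1, h2⟩ := hS _ (hf r hn)
  have hT0 : 0 < T := by linarith
  simp only [abs_div, abs_of_pos hT0, div_le_iff₀ hT0] at h1 h2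
  exact hR r h1 h2

lemma sieve_equi {x y : ℝ} (h : Irr x y) {F : ℝ × ℝ → ℝ} {A B : ℝ} (hA : 0 ≤ A) (hB : 0 ≤ B)
    (hF : Continuous F) (hS : BoxSupp F A B) (N : ℕ) (hN : N ≠ 0) :
    Tendsto (fun T : ℝ => (1 / T) * ∑' r, (if Nat.Coprime (gc r) N then F (zf x y r, sf x y r / T) else 0)) atTop
      (𝓝 ((∑ d ∈ N.divisors, (ArithmeticFunction.moebius d : ℝ) * ((d : ℝ) ^ 2)⁻¹) *
        ((1 / (x ^ 2 + y ^ 2)) * ∫ p, F p))) := by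
  have key := tendsto_finsetSum (s := N.divisors) fun d hd =>
    (div_equi h hA hB hF hS d (Nat.pos_of_mem_divisors hd)).const_mul (ArithmeticFunction.moebius d : ℝ)
  have e : (∑ d ∈ N.divisors, (ArithmeticFunction.moebius d : ℝ) * ((d : ℝ) ^ 2)⁻¹) *
        ((1 / (x ^ 2 + y ^ 2)) * ∫ p, F p) = ∑ d ∈ N.divisors, (ArithmeticFunction.moebius d : ℝ) *
        ((1 / (x ^ 2 + y ^ 2)) * (((d : ℝ) ^ 2)⁻¹ * ∫ p, F p)) := by
    rw [Finset.sum_mul]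
    apply Finset.sum_congr rfl; intro d _; ring
  rw [e]
  refine key.congr' ?_
  filter_upwards [eventually_ge_atTop 1] with T hT
  have e2 : ∀ r, (if Nat.Coprime (gc r) N then F (zf x y r, sf x y r / T) else 0)
      = ∑ d ∈ N.divisors, (ArithmeticFunction.moebius d : ℝ) *
        (if d ∣ gc r then F (zf x y r, sf x y r / T) else 0) := by
    intro r
    have := congrArg (· * F (zf x y r, sf x y r / T)) (sieve_id (gc r) N hN)
    simp only [Finset.sum_mul, ite_mul, zero_mul, one_mul] at this
    rw [← this]
    apply Finset.sum_congr rfl; intro d _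
    split_ifs <;> simp
  simp only [e2]
  rw [Summable.tsum_finsetSum, Finset.mul_sum]
  · apply Finset.sum_congr rfl; intro d _
    rw [tsum_mul_left]; ring
  · intro d _
    apply Summable.mul_left
    apply finite_summable_aux h hA hB hS T hT
    intro r hr
    by_contra hn
    simp [hn] at hr

lemma prim_decomp (r : ℤ × ℤ) (hr : gc r ≠ 0) : ∃ p : ℤ × ℤ, gc p = 1 ∧
    r = ((gc r : ℤ) * p.1, (gc r : ℤ) * p.2) := by
  have hpos : 0 < Int.gcd r.1 r.2 := Nat.pos_of_ne_zero hr
  obtain ⟨m, n, h1, h2, h3⟩ := Int.exists_gcd_one hpos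
  refine ⟨(m, n), h1, Prod.ext ?_ ?_⟩
  · simp only [gc]; rw [mul_comm]; exact h2
  · simp only [gc]; rw [mul_comm]; exact h3

lemma prim_sep {x y : ℝ} {p p' : ℤ × ℤ} (hp : gc p = 1) (hp' : gc p' = 1)
    (hz : 0 < zf x y p) (hz' : 0 < zf x y p') (hne : p ≠ p') :
    x ^ 2 + y ^ 2 ≤ |zf x y p * sf x y p' - zf x y p' * sf x y p| := by
  have e : zf x y p * sf x y p' - zf x y p' * sf x y p
      = ((p.1 * p'.2 - p.2 * p'.1 : ℤ) : ℝ) * (x ^ 2 + y ^ 2) := by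
    simp only [zf, sf]; push_cast; ring
  have hdet : p.1 * p'.2 - p.2 * p'.1 ≠ 0 := by
    intro h0
    apply hne
    have hb := Int.gcd_eq_gcd_ab p.1 p.2
    simp only [gc] at hp hp'
    rw [hp] at hb
    set u := Int.gcdA p.1 p.2
    set w := Int.gcdB p.1 p.2
    push_cast at hb
    set k := u * p'.1 + w * p'.2 with hk
    have e1 : p'.1 = p.1 * k := by
      rw [hk]; linear_combination p'.1 * hb - w * h0
    have e2 : p'.2 = p.2 * k := by
      rw [hk]; linear_combination p'.2 * hb + u * h0
    have hk1 : k.natAbs = 1 := by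
      have : k ∣ (Int.gcd p'.1 p'.2 : ℤ) := Int.dvd_coe_gcd ⟨p.1, by rw [e1]; ring⟩ ⟨p.2, by rw [e2]; ring⟩
      rw [hp'] at this
      exact Int.natAbs_of_isUnit (isUnit_of_dvd_one this)
    have hzk : zf x y p' = zf x y p * k := by
      simp only [zf, e1, e2]; push_cast; ring
    have hkpos : (0 : ℝ) < k := by
      rw [hzk] at hz'; exact (pos_iff_pos_of_mul_pos hz').1 hz
    have : 0 < k := by exact_mod_cast hkpos
    have : k = 1 := by omega
    rw [this, mul_one] at e1 e2
    exact Prod.ext e1.symm e2.symm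
  rw [e, abs_mul, ← Int.cast_abs]
  have h1 : (1 : ℝ) ≤ ((|p.1 * p'.2 - p.2 * p'.1| : ℤ) : ℝ) := by
    exact_mod_cast Int.one_le_abs hdet
  have hq : 0 ≤ x ^ 2 + y ^ 2 := by positivity
  rw [abs_of_nonneg hq]
  nlinarith

lemma prim_count {x y : ℝ} (h : Irr x y) {a b L : ℝ} (ha : 0 < a) (hb : 0 < b) (hL : 0 ≤ L) (R : Finset (ℤ × ℤ))
    (hR : ∀ p ∈ R, gc p = 1 ∧ a ≤ zf x y p ∧ zf x y p ≤ b ∧ |sf x y p| ≤ L) :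
    (R.card : ℝ) ≤ 2 + 2 * (L / a) * b ^ 2 / (x ^ 2 + y ^ 2) := by
  have hq := h.q_pos
  set q := x ^ 2 + y ^ 2 with hqd
  set δ := q / b ^ 2 with hδ
  have hδ0 : 0 < δ := by positivity
  let f : ℤ × ℤ → ℤ := fun p => ⌊sf x y p / zf x y p / δ⌋
  have hmaps : ∀ p ∈ R, f p ∈ Finset.Icc ⌊-(L / a / δ)⌋ ⌊L / a / δ⌋ := by
    intro p hp
    obtain ⟨-, h1, h2, h3⟩ := hR p hp
    have hz : 0 < zf x y p := by linarith
    have : |sf x y p / zf x y p / δ| ≤ L / a / δ := by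
      rw [abs_div, abs_div, abs_of_pos hz, abs_of_pos hδ0]
      gcongr
    rw [abs_le] at this
    simp only [Finset.mem_Icc, f]
    exact ⟨Int.floor_le_floor this.1, Int.floor_le_floor this.2⟩
  have hinj : Set.InjOn f R := by
    intro p hp p' hp' hpp
    by_contra hne
    obtain ⟨g1, h1, h2, h3⟩ := hR p hp
    obtain ⟨g1', h1', h2', h3'⟩ := hR p' hp'
    have hz : 0 < zf x y p := by linarith
    have hz' : 0 < zf x y p' := by linarith
    have hs := prim_sep g1 g1' hz hz' hne
    have := Int.abs_sub_lt_one_of_floor_eq_floor hpp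
    rw [← sub_div, abs_div, abs_of_pos hδ0, div_lt_one hδ0, div_sub_div _ _ hz.ne' hz'.ne', abs_div,
      abs_of_pos (mul_pos hz hz'), div_lt_iff₀ (mul_pos hz hz')] at this
    have h4 : zf x y p * zf x y p' ≤ b ^ 2 := by nlinarith
    have h5 : δ * (zf x y p * zf x y p') ≤ q := by
      rw [hδ, div_mul_eq_mul_div, div_le_iff₀ (by positivity)]; nlinarith
    rw [abs_sub_comm, mul_comm (sf x y p)] at this
    linarith
  have hc := Finset.card_le_card_of_injOn f hmaps hinj
  rw [Int.card_Icc] at hc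
  have hc' : (R.card : ℝ) ≤ (((⌊L / a / δ⌋ + 1 - ⌊-(L / a / δ)⌋).toNat : ℕ) : ℝ) := by exact_mod_cast hc
  refine hc'.trans ?_
  have hX : L / a / δ = (L / a) * b ^ 2 / q := by rw [hδ]; field_simp
  have hX0 : 0 ≤ L / a / δ := by positivity
  rw [← Int.cast_natCast, Int.toNat_eq_max]
  push_cast
  apply max_le
  · have := Int.floor_le (L / a / δ)
    have := Int.lt_floor_add_one (-(L / a / δ))
    have e : 2 * (L / a) * b ^ 2 / q = 2 * (L / a / δ) := by rw [hX]; ring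
    rw [e]
    linarith
  · positivity

lemma prim_tail {x y : ℝ} (h : Irr x y) {a b B : ℝ} (ha : 0 < a) (hb : 0 < b) (hB : 0 ≤ B) :
    ∃ C : ℝ, 0 < C ∧ ∀ D : ℕ, 1 ≤ D → ∀ η : ℝ, 0 < η → ∀ᶠ T : ℝ in atTop, ∃ R : Finset (ℤ × ℤ),
      (∀ r, a ≤ zf x y r → zf x y r ≤ b → |sf x y r| ≤ B * T → D < gc r → r ∈ R) ∧
      (R.card : ℝ) ≤ (η + C / D) * T := by
  have hq := h.q_pos
  set C0 := 2 * (B / a) * b ^ 2 / (x ^ 2 + y ^ 2) with hC0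
  have hC0' : 0 ≤ C0 := by positivity
  refine ⟨C0 + 1, by positivity, fun D hD η hη => ?_⟩
  obtain ⟨C1, -, HC1⟩ := box_count h b (B / (η / 2)) hb.le (by positivity)
  obtain ⟨R1, hR1, -⟩ := HC1 1 le_rfl
  obtain ⟨C2, -, HC2⟩ := box_count h b B hb.le hB
  have hev : ∀ᶠ T : ℝ in atTop, ∀ p ∈ R1, p ≠ 0 → b / |zf x y p| < η / 2 * T := by
    rw [eventually_all_finset]
    intro p _
    filter_upwards [(tendsto_id.const_mul_atTop (by positivity : 0 < η / 2)).eventually_gt_atTop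
      (b / |zf x y p|)] with T hT _
    exact hT
  filter_upwards [hev, eventually_ge_atTop 1,
    (tendsto_id.const_mul_atTop (by positivity : 0 < η / 2)).eventually_gt_atTop 1] with T hT hT1 hT2
  simp only [id] at hT2
  have hT0 : 0 < T := by linarith
  obtain ⟨R0, hR0, -⟩ := HC2 T hT1
  classical
  let R := R0.filter (fun r => a ≤ zf x y r ∧ zf x y r ≤ b ∧ |sf x y r| ≤ B * T ∧ D < gc r)
  refine ⟨R, ?_, ?_⟩
  · intro r h1 h2 h3 h4
    simp only [R, Finset.mem_filter]
    refine ⟨hR0 r ?_ h3, h1, h2, h3, h4⟩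
    rw [abs_of_pos (by linarith)]; exact h2
  set M := ⌊η / 2 * T⌋₊ with hM
  have hmaps : ∀ r ∈ R, gc r ∈ Finset.Ioc D M := by
    intro r hr
    simp only [R, Finset.mem_filter] at hr
    obtain ⟨-, h1, h2, h3, h4⟩ := hr
    rw [Finset.mem_Ioc]
    refine ⟨h4, ?_⟩
    rw [hM]
    apply Nat.le_floor
    by_contra hlt
    push Not at hlt
    obtain ⟨p, hp1, hp2⟩ := prim_decomp r (by omega)
    set d := gc r
    have hd0 : (0 : ℝ) < d := by
      have : 0 < d := by omega
      exact_mod_cast this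
    have ez : zf x y r = d * zf x y p := by rw [hp2, zf_smul]
    have es : sf x y r = d * sf x y p := by rw [hp2, sf_smul]
    have hzp : 0 < zf x y p := by
      have : 0 < (d : ℝ) * zf x y p := by rw [← ez]; linarith
      exact (pos_iff_pos_of_mul_pos this).1 hd0
    have hpR : p ∈ R1 := by
      apply hR1
      · rw [abs_of_pos hzp]
        have : (1 : ℝ) ≤ d := by linarith
        nlinarith
      · rw [mul_one, le_div_iff₀ (by positivity)]
        rw [es, abs_mul, Nat.abs_cast] at h3
        have h5 : |sf x y p| * (η / 2 * T) ≤ d * |sf x y p| := by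
          nlinarith [abs_nonneg (sf x y p)]
        have h6 : (|sf x y p| * (η / 2)) * T ≤ B * T := by linarith
        exact le_of_mul_le_mul_right h6 hT0
    have hp0 : p ≠ 0 := by
      rintro rfl
      simp [gc] at hp1
    have := hT p hpR hp0
    rw [abs_of_pos hzp, div_lt_iff₀ hzp] at this
    nlinarith
  rw [Finset.card_eq_sum_card_fiberwise hmaps]
  have hfib : ∀ d ∈ Finset.Ioc D M, ((R.filter (fun r => gc r = d)).card : ℝ) ≤ 2 + C0 * T * ((d : ℝ) ^ 2)⁻¹ := by
    intro d hd
    rw [Finset.mem_Ioc] at hd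
    have hd0' : 0 < d := by omega
    have hd0 : (0 : ℝ) < d := by exact_mod_cast hd0'
    let f : ℤ × ℤ → ℤ × ℤ := fun r => (r.1 / d, r.2 / d)
    have hf : ∀ r ∈ R.filter (fun r => gc r = d), gc (f r) = 1 ∧ r = ((d : ℤ) * (f r).1, (d : ℤ) * (f r).2) := by
      intro r hr
      rw [Finset.mem_filter] at hr
      obtain ⟨p, hp1, hp2⟩ := prim_decomp r (by omega)
      rw [hr.2] at hp2
      have : f r = p := by
        have hdz : (d : ℤ) ≠ 0 := by omega
        simp only [f, hp2]
        rw [Int.mul_ediv_cancel_left _ hdz, Int.mul_ediv_cancel_left _ hdz]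
      rw [this]; exact ⟨hp1, hp2⟩
    have hinj : Set.InjOn f (R.filter (fun r => gc r = d)) := by
      intro r hr r' hr' hrr
      rw [(hf r hr).2, (hf r' hr').2, hrr]
    rw [← Finset.card_image_of_injOn hinj]
    have := prim_count h (a := a / d) (b := b / d) (L := B * T / d) (by positivity) (by positivity)
      (by positivity) ((R.filter (fun r => gc r = d)).image f) (by
        intro p hp
        rw [Finset.mem_image] at hp
        obtain ⟨r, hr, rfl⟩ := hp
        obtain ⟨h1, h2⟩ := hf r hr
        simp only [R, Finset.mem_filter] at hr
        have ez : zf x y r = d * zf x y (f r) := by rw [← zf_smul, ← h2]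
        have es : sf x y r = d * sf x y (f r) := by rw [← sf_smul, ← h2]
        obtain ⟨⟨-, g1, g2, g3, g4⟩, g5⟩ := hr
        rw [ez] at g1 g2
        rw [es, abs_mul, Nat.abs_cast] at g3
        refine ⟨h1, ?_, ?_, ?_⟩
        · rw [div_le_iff₀ hd0]; linarith
        · rw [le_div_iff₀ hd0]; linarith
        · rw [le_div_iff₀ hd0]; linarith)
    refine this.trans (le_of_eq ?_)
    rw [hC0]; field_simp
  push_cast
  refine (Finset.sum_le_sum hfib).trans ?_
  rw [Finset.sum_add_distrib, ← Finset.mul_sum, Finset.sum_const, nsmul_eq_mul, Nat.card_Ioc]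
  have hD0 : (0 : ℝ) < D := by exact_mod_cast hD
  have hs : ∑ d ∈ Finset.Ioc D M, ((d : ℝ) ^ 2)⁻¹ ≤ (D : ℝ)⁻¹ := by
    rcases le_total D M with hDM | hDM
    · have := sum_Ioc_inv_sq_le_sub (α := ℝ) (k := D) (n := M) (by omega) hDM
      have h2 : (0 : ℝ) ≤ (M : ℝ)⁻¹ := by positivity
      linarith
    · rw [Finset.Ioc_eq_empty_of_le hDM]; simp
  have h1 : ((M - D : ℕ) : ℝ) ≤ η / 2 * T := by
    have h3 : ((M - D : ℕ) : ℝ) ≤ M := by exact_mod_cast Nat.sub_le _ _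
    exact h3.trans (Nat.floor_le (by positivity))
  have h2 := mul_le_mul_of_nonneg_left hs (by positivity : 0 ≤ C0 * T)
  have h4 : (η + (C0 + 1) / D) * T = η * T + C0 * T * (D : ℝ)⁻¹ + T * (D : ℝ)⁻¹ := by
    field_simp; ring
  have h5 : 0 ≤ T * (D : ℝ)⁻¹ := by positivity
  rw [h4]; linarith

def kap : ℝ := ∑' d : ℕ, (ArithmeticFunction.moebius d : ℝ) * ((d : ℝ) ^ 2)⁻¹

lemma kap_abs (d : ℕ) : |(ArithmeticFunction.moebius d : ℝ) * ((d : ℝ) ^ 2)⁻¹| ≤ 1 / (d : ℝ) ^ 2 := by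
  rw [abs_mul, one_div, abs_of_nonneg (by positivity : (0 : ℝ) ≤ ((d : ℝ) ^ 2)⁻¹)]
  have : |(ArithmeticFunction.moebius d : ℝ)| ≤ 1 := by
    have := ArithmeticFunction.abs_moebius_le_one (n := d)
    exact_mod_cast this
  have h2 : (0 : ℝ) ≤ ((d : ℝ) ^ 2)⁻¹ := by positivity
  nlinarith

lemma kap_summable : Summable fun d : ℕ => (ArithmeticFunction.moebius d : ℝ) * ((d : ℝ) ^ 2)⁻¹ :=
  Summable.of_norm_bounded hasSum_zeta_two.summable kap_abs

lemma kap_pos : 0 < kap := by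
  have h1 := kap_summable.hasSum.add hasSum_zeta_two
  have h2 := le_hasSum h1 1 (fun d _ => by
    have := kap_abs d
    rw [abs_le] at this
    linarith)
  simp at h2
  have h3 := Real.pi_lt_d2
  have h4 := Real.pi_pos
  unfold kap
  nlinarith

lemma kap_lim : Tendsto (fun D : ℕ => ∑ d ∈ (D.factorial).divisors,
    (ArithmeticFunction.moebius d : ℝ) * ((d : ℝ) ^ 2)⁻¹) atTop (𝓝 kap) := by
  classical
  have h : Tendsto (fun D : ℕ => insert 0 (D.factorial).divisors) atTop atTop := by
    apply tendsto_atTop_finset_of_monotone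
    · intro D D' hD
      apply Finset.insert_subset_insert
      exact Nat.divisors_subset_of_dvd (Nat.factorial_ne_zero _) (Nat.factorial_dvd_factorial hD)
    · intro d
      refine ⟨d, ?_⟩
      rcases Nat.eq_zero_or_pos d with rfl | hd
      · simp
      · apply Finset.mem_insert_of_mem
        rw [Nat.mem_divisors]
        exact ⟨Nat.dvd_factorial hd le_rfl, Nat.factorial_ne_zero _⟩
  have := (show HasSum _ kap from kap_summable.hasSum)
  refine (Tendsto.comp this h).congr fun D => ?_
  simp

def SliceSupp (F : ℝ × ℝ → ℝ) (a b B : ℝ) : Prop :=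
  ∀ p, F p ≠ 0 → a ≤ p.1 ∧ p.1 ≤ b ∧ |p.2| ≤ B

lemma SliceSupp.box {F : ℝ × ℝ → ℝ} {a b B : ℝ} (ha : 0 < a) (h : SliceSupp F a b B) :
    BoxSupp F b B := by
  intro p hp
  obtain ⟨h1, h2, h3⟩ := h p hp
  exact ⟨by rw [abs_of_pos (by linarith)]; exact h2, h3⟩

lemma prim_equi {x y : ℝ} (h : Irr x y) {F : ℝ × ℝ → ℝ} {a b B : ℝ} (ha : 0 < a) (hb : 0 < b)
    (hB : 0 ≤ B) (hF : Continuous F) (hS : SliceSupp F a b B) :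
    Tendsto (fun T : ℝ => (1 / T) * ∑' r, (if gc r = 1 then F (zf x y r, sf x y r / T) else 0)) atTop
      (𝓝 (kap / (x ^ 2 + y ^ 2) * ∫ p, F p)) := by
  have hBox := hS.box ha
  obtain ⟨M, hM, hMF⟩ := hBox.bdd hF
  obtain ⟨C, hC, HC⟩ := prim_tail h ha hb hB
  set I := (1 / (x ^ 2 + y ^ 2)) * ∫ p, F p with hI
  have eI : kap / (x ^ 2 + y ^ 2) * (∫ p, F p) = kap * I := by rw [hI]; ring
  rw [eI, Metric.tendsto_nhds]
  intro ε hε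
  have hk : Tendsto (fun D : ℕ => (∑ d ∈ (D.factorial).divisors,
    (ArithmeticFunction.moebius d : ℝ) * ((d : ℝ) ^ 2)⁻¹) * I) atTop (𝓝 (kap * I)) := kap_lim.mul_const I
  rw [Metric.tendsto_nhds] at hk
  have hD2 : ∀ᶠ D : ℕ in atTop, M * (C / D) < ε / 4 := by
    have : Tendsto (fun D : ℕ => M * (C / D)) atTop (𝓝 (M * 0)) :=
      (tendsto_const_div_atTop_nhds_zero_nat C).const_mul M
    rw [mul_zero] at this
    exact this.eventually_lt_const (by positivity)
  obtain ⟨D, hD1, hD2, hD3⟩ := ((hk (ε / 4) (by positivity)).and (hD2.and (eventually_ge_atTop 1))).exists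
  have hsv := sieve_equi h hb.le hB hF hBox D.factorial (Nat.factorial_ne_zero _)
  rw [Metric.tendsto_nhds] at hsv
  filter_upwards [hsv (ε / 4) (by positivity), HC D hD3 (ε / (4 * M)) (by positivity),
    eventually_ge_atTop 1] with T hT1 hT2 hT3
  have hT0 : 0 < T := by linarith
  obtain ⟨R, hR1, hR2⟩ := hT2
  have hs1 : Summable fun r => (if Nat.Coprime (gc r) D.factorial then F (zf x y r, sf x y r / T) else 0) := by
    apply finite_summable_aux h hb.le hB hBox T hT3
    intro r hr hn
    simp [hn] at hr
  have hs2 : Summable fun r => (if gc r = 1 then F (zf x y r, sf x y r / T) else 0) := by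
    apply finite_summable_aux h hb.le hB hBox T hT3
    intro r hr hn
    simp [hn] at hr
  have hdiff := hs1.tsum_sub hs2
  have hle := tsum_abs_le_card (f := fun r => (if Nat.Coprime (gc r) D.factorial then F (zf x y r, sf x y r / T) else 0)
    - (if gc r = 1 then F (zf x y r, sf x y r / T) else 0)) (ω := M) R (by
      intro r hr
      have hF0 : F (zf x y r, sf x y r / T) ≠ 0 := by
        intro hn; simp [hn] at hr
      obtain ⟨g1, g2, g3⟩ := hS _ hF0
      simp only [abs_div, abs_of_pos hT0, div_le_iff₀ hT0] at g1 g2 g3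
      refine hR1 r g1 g2 g3 ?_
      have hg1 : gc r ≠ 1 := by
        intro h1; simp [h1] at hr
      have hco : Nat.Coprime (gc r) D.factorial := by
        by_contra hn; simp [hn, hg1] at hr
      have hg0 : gc r ≠ 0 := by
        intro h0
        have : r.1 = 0 ∧ r.2 = 0 := Int.gcd_eq_zero_iff.1 h0
        simp [zf, this.1, this.2] at g1
        linarith
      by_contra hle
      push Not at hle
      have h1 : gc r ∣ D.factorial := Nat.dvd_factorial (Nat.pos_of_ne_zero hg0) hle
      exact hg1 (Nat.Coprime.eq_one_of_dvd hco h1)) (by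
      intro r
      by_cases hg : gc r = 1
      · simp [hg, hM.le]
      · simp only [hg, if_false, sub_zero]
        split_ifs
        · exact hMF _
        · simp [hM.le])
  rw [hdiff] at hle
  set S1 := ∑' r, (if Nat.Coprime (gc r) D.factorial then F (zf x y r, sf x y r / T) else 0)
  set S2 := ∑' r, (if gc r = 1 then F (zf x y r, sf x y r / T) else 0)
  rw [Real.dist_eq] at hT1 hD1 ⊢
  have h1 : |1 / T * S1 - 1 / T * S2| ≤ ε / 4 + ε / 4 := by
    rw [← mul_sub, abs_mul, abs_of_pos (by positivity : 0 < 1 / T)]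
    have : |S1 - S2| ≤ M * ((ε / (4 * M) + C / D) * T) := hle.trans (by gcongr)
    rw [one_div_mul_eq_div, div_le_iff₀ hT0]
    have e : M * ((ε / (4 * M) + C / D) * T) = (ε / 4 + M * (C / D)) * T := by
      field_simp
    rw [e] at this
    refine this.trans ?_
    gcongr
  rw [abs_sub_lt_iff] at hT1 hD1 ⊢
  rw [abs_sub_le_iff] at h1
  constructor <;> linarith

def grow (γ : SL2Z) (i : Fin 2) : ℤ × ℤ := (γ i 0, γ i 1)

def rsum (γ : SL2Z) : ℤ × ℤ := grow γ 0 + grow γ 1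

def PosG (x y : ℝ) (γ : SL2Z) : Prop := 0 < zf x y (grow γ 0) ∧ 0 < zf x y (grow γ 1)

lemma row_det (γ : SL2Z) : (grow γ 0).1 * (grow γ 1).2 - (grow γ 0).2 * (grow γ 1).1 = 1 := by
  have := γ.det_coe
  rw [Matrix.det_fin_two] at this
  simpa [grow] using this

lemma row_ext {γ γ' : SL2Z} (h0 : grow γ 0 = grow γ' 0) (h1 : grow γ 1 = grow γ' 1) : γ = γ' := by
  simp only [grow, Prod.mk.injEq] at h0 h1
  ext i j
  fin_cases i <;> fin_cases j
  · exact h0.1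
  · exact h0.2
  · exact h1.1
  · exact h1.2

lemma rsum_det (γ : SL2Z) : (rsum γ).1 * (grow γ 1).2 - (rsum γ).2 * (grow γ 1).1 = 1 := by
  have := row_det γ
  simp only [rsum, Prod.fst_add, Prod.snd_add]
  linarith

lemma rsum_gc (γ : SL2Z) : gc (rsum γ) = 1 := by
  have := rsum_det γ
  rw [gc, ← Int.isCoprime_iff_gcd_eq_one]
  exact ⟨(grow γ 1).2, -(grow γ 1).1, by linarith⟩

lemma rsum_inj {x y : ℝ} : Set.InjOn rsum {γ | PosG x y γ} := by
  intro γ hγ γ' hγ' hr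
  have d1 := rsum_det γ
  have d2 := rsum_det γ'
  rw [← hr] at d2
  obtain ⟨p0, p1⟩ := hγ
  obtain ⟨p0', p1'⟩ := hγ'
  have z1 : zf x y (rsum γ) = zf x y (grow γ 0) + zf x y (grow γ 1) := by simp [rsum, zf_add]
  have z2 : zf x y (rsum γ) = zf x y (grow γ' 0) + zf x y (grow γ' 1) := by
    rw [hr]; simp [rsum, zf_add]
  set r := rsum γ with hrd
  set u := grow γ 1 with hu
  set u' := grow γ' 1 with hu'
  -- difference is a multiple of r
  set k := u.1 * u'.2 - u.2 * u'.1 with hk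
  have e1 : u'.1 - u.1 = (-k) * r.1 := by
    rw [hk]; linear_combination u.1 * d2 - u'.1 * d1
  have e2 : u'.2 - u.2 = (-k) * r.2 := by
    rw [hk]; linear_combination u.2 * d2 - u'.2 * d1
  have ez : zf x y u' - zf x y u = -(k : ℝ) * zf x y r := by
    have e1' : ((u'.1 : ℝ) - u.1) = -k * r.1 := by exact_mod_cast e1
    have e2' : ((u'.2 : ℝ) - u.2) = -k * r.2 := by exact_mod_cast e2
    simp only [zf]
    linear_combination x * e1' + y * e2'
  have hzr : 0 < zf x y r := by linarith
  have hk0 : k = 0 := by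
    have a1 : (k : ℝ) < 1 := by
      by_contra hn; push Not at hn
      nlinarith
    have a2 : (-1 : ℝ) < k := by
      by_contra hn; push Not at hn
      nlinarith
    have a1' : k < 1 := by exact_mod_cast a1
    have a2' : -1 < k := by exact_mod_cast a2
    omega
  rw [hk0] at e1 e2
  have hu1 : u = u' := Prod.ext (by linarith) (by linarith)
  refine row_ext ?_ hu1
  have : grow γ 0 + u = grow γ' 0 + u' := hr
  rw [← hu1] at this
  exact add_right_cancel this

lemma rsum_surj {x y : ℝ} (h : Irr x y) {r : ℤ × ℤ} (hr : gc r = 1) (hz : 0 < zf x y r) :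
    ∃ γ : SL2Z, PosG x y γ ∧ rsum γ = r := by
  have hb := Int.gcd_eq_gcd_ab r.1 r.2
  simp only [gc] at hr
  rw [hr] at hb
  push_cast at hb
  set u : ℤ × ℤ := (-Int.gcdB r.1 r.2, Int.gcdA r.1 r.2) with hu
  have hdu : r.1 * u.2 - r.2 * u.1 = 1 := by rw [hu]; simp only; linarith
  set k := ⌊zf x y u / zf x y r⌋ with hk
  set r2 : ℤ × ℤ := (u.1 - k * r.1, u.2 - k * r.2) with hr2
  have hd2 : r.1 * r2.2 - r.2 * r2.1 = 1 := by rw [hr2]; simp only; linarith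
  have ez : zf x y r2 = zf x y u - k * zf x y r := by
    simp only [zf, hr2]; push_cast; ring
  have k1 : (k : ℝ) * zf x y r ≤ zf x y u := by
    rw [← le_div_iff₀ hz]; exact Int.floor_le _
  have k2 : zf x y u < (k + 1) * zf x y r := by
    rw [← div_lt_iff₀ hz]; exact Int.lt_floor_add_one _
  have h2ne : zf x y r2 ≠ 0 := by
    apply zf_ne h
    intro h0
    rw [h0] at hd2
    simp at hd2
  have h2pos : 0 < zf x y r2 := lt_of_le_of_ne (by linarith) h2ne.symm
  let M : Matrix (Fin 2) (Fin 2) ℤ := !![r.1 - r2.1, r.2 - r2.2; r2.1, r2.2]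
  have hM : M.det = 1 := by
    simp only [M, Matrix.det_fin_two_of]; linarith
  let γ : SL2Z := ⟨M, hM⟩
  have row0 : grow γ 0 = r - r2 := rfl
  have row1 : grow γ 1 = r2 := rfl
  refine ⟨γ, ⟨?_, ?_⟩, ?_⟩
  · rw [row0]
    have : zf x y (r - r2) = zf x y r - zf x y r2 := by simp [zf]; ring
    rw [this]; linarith
  · rw [row1]; exact h2pos
  · rw [rsum, row0, row1]; simp

open Classical in
lemma gam_bij {x y : ℝ} (h : Irr x y) (f : ℤ × ℤ → ℝ) (hf : ∀ r, f r ≠ 0 → 0 < zf x y r) :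
    ∑' γ : SL2Z, (if PosG x y γ then f (rsum γ) else 0) = ∑' r, (if gc r = 1 then f r else 0) := by
  symm
  have hp : ∀ γ : Function.support (fun γ : SL2Z => if PosG x y γ then f (rsum γ) else 0), PosG x y γ.1 := by
    intro γ
    by_contra hn
    have h2 := γ.2
    rw [Function.mem_support] at h2
    exact h2 (if_neg hn)
  apply tsum_eq_tsum_of_ne_zero_bij (fun γ => rsum γ.1)
  · intro γ γ' hh
    exact Subtype.ext (rsum_inj (hp γ) (hp γ') hh)
  · intro r hr
    have h1 : gc r = 1 := by
      by_contra hn; simp [hn] at hr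
    have h2 : f r ≠ 0 := by
      intro hn; simp [hn] at hr
    obtain ⟨γ, g1, g2⟩ := rsum_surj h h1 (hf r h2)
    refine ⟨⟨γ, ?_⟩, g2⟩
    simp [g1, g2, h2]
  · intro γ
    simp [hp γ, rsum_gc]

/-- summation over positive `γ` -/
lemma gam_equi {x y : ℝ} (h : Irr x y) {F : ℝ × ℝ → ℝ} {a b B : ℝ} (ha : 0 < a) (hb : 0 < b)
    (hB : 0 ≤ B) (hF : Continuous F) (hS : SliceSupp F a b B) :
    Tendsto (fun T : ℝ => (1 / T) * ∑' γ : SL2Z, open Classical in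
      (if PosG x y γ then F (zf x y (rsum γ), sf x y (rsum γ) / T) else 0)) atTop
      (𝓝 (kap / (x ^ 2 + y ^ 2) * ∫ p, F p)) := by
  refine (prim_equi h ha hb hB hF hS).congr fun T => ?_
  congr 1
  rw [← gam_bij h (fun r => F (zf x y r, sf x y r / T))]
  intro r hr
  have := (hS _ hr).1
  simp only at this
  linarith

lemma pos_finite {x y : ℝ} (h : Irr x y) (A B : ℝ) (hA : 0 ≤ A) (hB : 0 ≤ B) :
    {γ : SL2Z | PosG x y γ ∧ |zf x y (rsum γ)| ≤ A ∧ |sf x y (rsum γ)| ≤ B}.Finite := by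
  obtain ⟨C, -, HC⟩ := box_count h A B hA hB
  obtain ⟨R, hR, -⟩ := HC 1 le_rfl
  apply Set.Finite.of_finite_image (f := rsum)
  · apply R.finite_toSet.subset
    rintro _ ⟨γ, ⟨-, h1, h2⟩, rfl⟩
    exact hR _ h1 (by linarith)
  · exact rsum_inj.mono fun γ hγ => hγ.1

/-- A matrix `(a b; c d)` in `SL2Z`, reindexing on the left. -/
lemma row_mul (A γ : SL2Z) (i : Fin 2) :
    grow (A * γ) i = (A i 0 * (grow γ 0).1 + A i 1 * (grow γ 1).1, A i 0 * (grow γ 0).2 + A i 1 * (grow γ 1).2) := by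
  simp [grow, Matrix.SpecialLinearGroup.coe_mul, Matrix.mul_apply, Fin.sum_univ_two]

lemma zf_row_mul (x y : ℝ) (A γ : SL2Z) (i : Fin 2) :
    zf x y (grow (A * γ) i) = A i 0 * zf x y (grow γ 0) + A i 1 * zf x y (grow γ 1) := by
  rw [row_mul]; simp [zf]; ring

lemma sf_row_mul (x y : ℝ) (A γ : SL2Z) (i : Fin 2) :
    sf x y (grow (A * γ) i) = A i 0 * sf x y (grow γ 0) + A i 1 * sf x y (grow γ 1) := by
  rw [row_mul]; simp [sf]; ring

lemma zs_det (x y : ℝ) (γ : SL2Z) : zf x y (grow γ 0) * sf x y (grow γ 1) -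
    zf x y (grow γ 1) * sf x y (grow γ 0) = x ^ 2 + y ^ 2 := by
  have := row_det γ
  have h2 : ((grow γ 0).1 * (grow γ 1).2 - (grow γ 0).2 * (grow γ 1).1 : ℝ) = 1 := by exact_mod_cast this
  simp only [zf, sf]
  linear_combination (x ^ 2 + y ^ 2) * h2

def ell (e : ℝ × ℝ) : ℝ := e.1 + e.2

def Cone (e e' : ℝ × ℝ) : Prop :=
  0 ≤ e.1 ∧ 0 ≤ e.2 ∧ 0 ≤ e'.1 ∧ 0 ≤ e'.2 ∧ e.1 * e'.2 - e.2 * e'.1 = 1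

def ms (e e' : ℝ × ℝ) : ℝ := 1 / (ell e * ell e')

lemma ell_add (e e' : ℝ × ℝ) : ell (e + e') = ell e + ell e' := by simp [ell]; ring
lemma ell_smul (c : ℝ) (e : ℝ × ℝ) : ell (c • e) = c * ell e := by simp [ell]; ring

lemma Cone.pos {e e' : ℝ × ℝ} (h : Cone e e') : 0 < ell e := by
  obtain ⟨h1, h2, h3, h4, h5⟩ := h
  unfold ell
  by_contra hn
  have a1 : e.1 = 0 := by linarith
  have a2 : e.2 = 0 := by linarith
  rw [a1, a2] at h5; simp at h5

lemma Cone.left {e e' : ℝ × ℝ} (h : Cone e e') : Cone e (e + e') := by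
  obtain ⟨h1, h2, h3, h4, h5⟩ := h
  refine ⟨h1, h2, add_nonneg h1 h3, add_nonneg h2 h4, ?_⟩
  simp only [Prod.fst_add, Prod.snd_add]; linarith

lemma Cone.right {e e' : ℝ × ℝ} (h : Cone e e') : Cone (e + e') e' := by
  obtain ⟨h1, h2, h3, h4, h5⟩ := h
  refine ⟨add_nonneg h1 h3, add_nonneg h2 h4, h3, h4, ?_⟩
  simp only [Prod.fst_add, Prod.snd_add]; linarith

lemma Cone.swap {e e' : ℝ × ℝ} (h : Cone e e') : Cone e'.swap e.swap := by
  obtain ⟨h1, h2, h3, h4, h5⟩ := h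
  refine ⟨h4, h3, h2, h1, ?_⟩
  simp only [Prod.fst_swap, Prod.snd_swap]; linarith

lemma ell_swap (e : ℝ × ℝ) : ell e.swap = ell e := by simp [ell, add_comm]

lemma ms_swap (e e' : ℝ × ℝ) : ms e'.swap e.swap = ms e e' := by simp [ms, ell_swap, mul_comm]

lemma Cone.pos' {e e' : ℝ × ℝ} (h : Cone e e') : 0 < ell e' := by
  rw [← ell_swap]; exact h.swap.pos

lemma Cone.ms_pos {e e' : ℝ × ℝ} (h : Cone e e') : 0 < ms e e' := by
  have := h.pos; have := h.pos'; unfold ms; positivity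

lemma ms_add {e e' : ℝ × ℝ} (h : Cone e e') : ms e e' = ms e (e + e') + ms (e + e') e' := by
  have := h.pos; have := h.pos'
  have : 0 < ell e + ell e' := by positivity
  simp only [ms, ell_add]
  field_simp
  ring

def uk (e e' : ℝ × ℝ) (k : ℕ) : ℝ × ℝ := e + (k : ℝ) • e'

lemma uk_zero (e e' : ℝ × ℝ) : uk e e' 0 = e := by simp [uk]
lemma uk_succ (e e' : ℝ × ℝ) (k : ℕ) : uk e e' (k + 1) = uk e e' k + e' := by
  simp [uk, add_smul, add_assoc]
lemma uk_add (e e' : ℝ × ℝ) (k n : ℕ) : uk (uk e e' k) e' n = uk e e' (k + n) := by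
  simp [uk, add_smul, add_assoc]
lemma uk_cone {e e' : ℝ × ℝ} (h : Cone e e') (k : ℕ) : Cone (uk e e' k) e' := by
  induction k with
  | zero => rwa [uk_zero]
  | succ k ih => rw [uk_succ]; exact ih.right

lemma ell_uk (e e' : ℝ × ℝ) (k : ℕ) : ell (uk e e' k) = ell e + k * ell e' := by
  rw [uk, ell_add, ell_smul]

def SubH (Δ : ℝ → ℝ × ℝ → ℝ × ℝ → ℝ) : Prop := ∀ e e', Cone e e' →
  ∀ᶠ T in atTop, Δ T e e' ≤ Δ T e (e + e') + Δ T (e + e') e'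

lemma farey_left {Δ : ℝ → ℝ × ℝ → ℝ × ℝ → ℝ} (hs : SubH Δ) {e e' : ℝ × ℝ} (h : Cone e e') (c : ℝ)
    (hc : ∀ k, ∀ᶠ T in atTop, Δ T (uk e e' k) (uk e e' (k + 1)) ≤ c * ms (uk e e' k) (uk e e' (k + 1)))
    (n : ℕ) : ∀ᶠ T in atTop, Δ T e e' ≤ c * (ms e e' - ms (uk e e' n) e') + Δ T (uk e e' n) e' := by
  induction n with
  | zero => simp [uk_zero]
  | succ n ih =>
    have hcn := uk_cone h n
    filter_upwards [ih, hc n, hs _ _ hcn] with T h1 h2 h3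
    have hm := ms_add hcn
    rw [← uk_succ] at hm h3
    rw [show ms e e' - ms (uk e e' (n + 1)) e' = (ms e e' - ms (uk e e' n) e') +
      ms (uk e e' n) (uk e e' (n + 1)) by linarith, mul_add]
    linarith

lemma farey_step {Δ : ℝ → ℝ × ℝ → ℝ × ℝ → ℝ} (hs : SubH Δ) {β η : ℝ} (hβ : η ≤ β) (K : ℕ)
    (H : ∀ e e', Cone e e' → ∀ᶠ T in atTop, Δ T e e' ≤ β * ms e e')
    (HG : ∀ e e', Cone e e' → ∀ k, K ≤ k →
      ∀ᶠ T in atTop, Δ T (uk e e' k) (uk e e' (k + 1)) ≤ η * ms (uk e e' k) (uk e e' (k + 1)))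
    {e e' : ℝ × ℝ} (h : Cone e e') (hl : ell e' ≤ ell e) :
    ∀ᶠ T in atTop, Δ T e e' ≤ (β - (β - η) * (1 / (2 * (1 + K)))) * ms e e' := by
  have hp := h.pos
  have hp' := h.pos'
  have hK : (0 : ℝ) ≤ K := Nat.cast_nonneg K
  obtain ⟨n, hn⟩ := exists_nat_ge ((ell e + K * ell e') / ell e')
  rw [div_le_iff₀ hp'] at hn
  have hA := farey_left hs h β (fun k => by
    have := uk_cone h k
    have h2 := this.left
    rw [← uk_succ] at h2
    exact H _ _ h2) K
  have hcK := uk_cone h K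
  have hB := farey_left hs hcK η (fun k => by
    rw [uk_add, uk_add]
    exact HG e e' h (K + k) (by omega)) n
  have hcn := uk_cone hcK n
  filter_upwards [hA, hB, H _ _ hcn] with T h1 h2 h3
  set m := ms e e'
  set m1 := ms (uk e e' K) e'
  set m2 := ms (uk (uk e e' K) e' n) e'
  have key : 1 / (2 * (1 + K)) * m ≤ m1 - m2 := by
    have e1 : m2 ≤ m1 / 2 := by
      simp only [m1, m2, ms, ell_uk]
      rw [div_div]
      apply one_div_le_one_div_of_le
      · positivity
      · nlinarith
    have e2 : 1 / (1 + K) * m ≤ m1 := by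
      simp only [m1, m, ms, ell_uk]
      rw [one_div_mul_one_div]
      apply one_div_le_one_div_of_le
      · positivity
      · have : ell e + K * ell e' ≤ (1 + K) * ell e := by nlinarith
        nlinarith
    have e3 : 1 / (2 * (1 + K)) * m = (1 / (1 + K) * m) / 2 := by field_simp
    rw [e3]; linarith
  have := mul_le_mul_of_nonneg_left key (sub_nonneg.2 hβ)
  nlinarith

lemma farey_step2 {Δ : ℝ → ℝ × ℝ → ℝ × ℝ → ℝ} (hs : SubH Δ) {β η : ℝ} (hβ : η ≤ β) (K : ℕ)
    (H : ∀ e e', Cone e e' → ∀ᶠ T in atTop, Δ T e e' ≤ β * ms e e')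
    (HG : ∀ e e', Cone e e' → ∀ k, K ≤ k →
      ∀ᶠ T in atTop, Δ T (uk e e' k) (uk e e' (k + 1)) ≤ η * ms (uk e e' k) (uk e e' (k + 1)))
    (HG' : ∀ e e', Cone e e' → ∀ k, K ≤ k →
      ∀ᶠ T in atTop, Δ T (uk e' e (k + 1)) (uk e' e k) ≤ η * ms (uk e' e (k + 1)) (uk e' e k))
    {e e' : ℝ × ℝ} (h : Cone e e') :
    ∀ᶠ T in atTop, Δ T e e' ≤ (β - (β - η) * (1 / (2 * (1 + K)))) * ms e e' := by
  rcases le_total (ell e') (ell e) with hl | hl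
  · exact farey_step hs hβ K H HG h hl
  · have swuk : ∀ (e e' : ℝ × ℝ) k, (uk e e' k).swap = uk e.swap e'.swap k := by
      intro e e' k; rfl
    have := farey_step (Δ := fun T e e' => Δ T e'.swap e.swap) (β := β) (η := η) (by
      intro e e' h
      filter_upwards [hs _ _ h.swap] with T hT
      have e1 : e'.swap + e.swap = (e + e').swap := by
        ext <;> simp [add_comm]
      rw [e1] at hT
      linarith) hβ K (by
      intro e e' h
      have := H _ _ h.swap
      rwa [ms_swap] at this) (by
      intro e e' h k hk
      have := HG' _ _ h.swap k hk
      rw [← swuk, ← swuk, ms_swap] at this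
      exact this) h.swap (by rwa [ell_swap, ell_swap])
    rw [ms_swap] at this
    simpa using this

lemma farey_main {Δ : ℝ → ℝ × ℝ → ℝ × ℝ → ℝ} (hs : SubH Δ) {A : ℝ}
    (H : ∀ e e', Cone e e' → ∀ᶠ T in atTop, Δ T e e' ≤ A * ms e e')
    (HG : ∀ η : ℝ, 0 < η → ∃ ε : ℝ, 0 < ε ∧ ∀ e e', Cone e e' → |e'.1 - e.1| ≤ ε * ell e →
      |e'.2 - e.2| ≤ ε * ell e → ∀ᶠ T in atTop, Δ T e e' ≤ η * ms e e') {e e' : ℝ × ℝ}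
    (h : Cone e e') {η : ℝ} (hη : 0 < η) : ∀ᶠ T in atTop, Δ T e e' ≤ η * ms e e' := by
  obtain ⟨ε, hε, hG⟩ := HG (η / 2) (by positivity)
  obtain ⟨K, hK⟩ := exists_nat_ge (1 / ε)
  rw [div_le_iff₀ hε] at hK
  have hK0 : (0 : ℝ) ≤ K := Nat.cast_nonneg K
  set A' := max A (η / 2) with hA'
  set c := 1 - 1 / (2 * (1 + (K : ℝ))) with hc
  have hfr : 1 / (2 * (1 + (K : ℝ))) ≤ 1 := by
    rw [div_le_one (by positivity)]; linarith
  have hfr0 : 0 < 1 / (2 * (1 + (K : ℝ))) := by positivity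
  have hc0 : 0 ≤ c := by rw [hc]; linarith
  have hc1 : c < 1 := by rw [hc]; linarith
  have coord : ∀ {e e' : ℝ × ℝ}, Cone e e' → e.1 ≤ ell e ∧ e.2 ≤ ell e := by
    intro e e' h
    obtain ⟨h1, h2, -⟩ := h
    unfold ell; constructor <;> linarith
  have iter : ∀ n : ℕ, ∀ e e', Cone e e' → ∀ᶠ T in atTop,
      Δ T e e' ≤ (η / 2 + c ^ n * (A' - η / 2)) * ms e e' := by
    intro n
    induction n with
    | zero =>
      intro e e' h
      filter_upwards [H e e' h] with T hT
      refine hT.trans (mul_le_mul_of_nonneg_right ?_ h.ms_pos.le)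
      have := le_max_left A (η / 2)
      simp only [pow_zero, one_mul]; linarith
    | succ n ih =>
      intro e e' h
      have hle : η / 2 ≤ η / 2 + c ^ n * (A' - η / 2) := by
        have := le_max_right A (η / 2)
        have := mul_nonneg (pow_nonneg hc0 n) (sub_nonneg.2 this)
        linarith
      have := farey_step2 hs hle K ih (by
        intro e e' h k hk
        have hck := (uk_cone h k).left
        rw [← uk_succ] at hck
        have hkr : (K : ℝ) ≤ k := by exact_mod_cast hk
        have hp := h.pos
        have hp' := h.pos'
        have hb : ell e' ≤ ε * ell (uk e e' k) := by
          rw [ell_uk]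
          nlinarith [mul_le_mul_of_nonneg_right hkr hε.le]
        have hco := coord h.swap
        rw [ell_swap] at hco
        apply hG _ _ hck
        · rw [uk_succ]; simp only [Prod.fst_add, add_sub_cancel_left]
          rw [abs_of_nonneg h.2.2.1]; exact hco.2.trans hb
        · rw [uk_succ]; simp only [Prod.snd_add, add_sub_cancel_left]
          rw [abs_of_nonneg h.2.2.2.1]; exact hco.1.trans hb) (by
        intro e e' h k hk
        have hck : Cone (uk e' e (k + 1)) (uk e' e k) := by
          have := (uk_cone h.swap k).left.swap
          rw [← uk_succ] at this
          exact this
        have hkr : (K : ℝ) ≤ k := by exact_mod_cast hk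
        have hp := h.pos
        have hp' := h.pos'
        have hb : ell e ≤ ε * ell (uk e' e (k + 1)) := by
          rw [ell_uk]
          push_cast
          nlinarith [mul_le_mul_of_nonneg_right hkr hε.le]
        have hco := coord h
        apply hG _ _ hck
        · rw [uk_succ] at hb ⊢; simp only [Prod.fst_add, sub_add_cancel_left, abs_neg]
          rw [abs_of_nonneg h.1]; exact hco.1.trans hb
        · rw [uk_succ] at hb ⊢; simp only [Prod.snd_add, sub_add_cancel_left, abs_neg]
          rw [abs_of_nonneg h.2.1]; exact hco.2.trans hb) h
      filter_upwards [this] with T hT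
      refine hT.trans (le_of_eq ?_)
      rw [pow_succ]
      congr 1
      rw [hc]; ring
  have hlim : Tendsto (fun n : ℕ => c ^ n * (A' - η / 2)) atTop (𝓝 (0 * (A' - η / 2))) :=
    (tendsto_pow_atTop_nhds_zero_of_lt_one hc0 hc1).mul_const _
  rw [zero_mul] at hlim
  obtain ⟨n, hn⟩ := (hlim.eventually_lt_const (by positivity : 0 < η / 2)).exists
  filter_upwards [iter n e e' h] with T hT
  refine hT.trans (mul_le_mul_of_nonneg_right ?_ h.ms_pos.le)
  linarith

structure TF (Ψ : (ℝ × ℝ) × (ℝ × ℝ) → ℝ) (a b B M : ℝ) : Prop where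
  uc : UniformContinuous Ψ
  nonneg : ∀ p, 0 ≤ Ψ p
  le : ∀ p, Ψ p ≤ M
  supp : ∀ p, Ψ p ≠ 0 → a ≤ ell p.1 ∧ ell p.1 ≤ b ∧ |ell p.2| ≤ B
  ha : 0 < a
  hb : 0 < b
  hB : 0 ≤ B

def gpt (x y T : ℝ) (e e' : ℝ × ℝ) (γ : SL2Z) : (ℝ × ℝ) × (ℝ × ℝ) :=
  (zf x y (grow γ 0) • e + zf x y (grow γ 1) • e',
   (sf x y (grow γ 0) / T) • e + (sf x y (grow γ 1) / T) • e')

open Classical in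
def cterm (x y : ℝ) (Ψ : (ℝ × ℝ) × (ℝ × ℝ) → ℝ) (T : ℝ) (e e' : ℝ × ℝ) (γ : SL2Z) : ℝ :=
  if PosG x y γ then Ψ (gpt x y T e e' γ) else 0

def csum (x y : ℝ) (Ψ : (ℝ × ℝ) × (ℝ × ℝ) → ℝ) (T : ℝ) (e e' : ℝ × ℝ) : ℝ :=
  (1 / T) * ∑' γ, cterm x y Ψ T e e' γ

lemma zf_rsum (x y : ℝ) (γ : SL2Z) : zf x y (rsum γ) = zf x y (grow γ 0) + zf x y (grow γ 1) := by
  simp [rsum, zf_add]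
lemma sf_rsum (x y : ℝ) (γ : SL2Z) : sf x y (rsum γ) = sf x y (grow γ 0) + sf x y (grow γ 1) := by
  simp [rsum, sf_add]

lemma cs_summable {x y : ℝ} (h : Irr x y) {Ψ : (ℝ × ℝ) × (ℝ × ℝ) → ℝ} {a b B M : ℝ} (hΨ : TF Ψ a b B M)
    {T : ℝ} (hT : 0 < T) {e e' : ℝ × ℝ} (hc : Cone e e') : Summable (cterm x y Ψ T e e') := by
  have hp := hc.pos
  have hp' := hc.pos'
  have ha := hΨ.ha
  have hb := hΨ.hb
  have hB := hΨ.hB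
  have hq := h.q_pos
  set μ := min (ell e) (ell e') with hμ
  have hμ0 : 0 < μ := lt_min hp hp'
  apply summable_of_hasFiniteSupport
  apply (pos_finite h (b / μ) ((b / μ * (B * T) + (x ^ 2 + y ^ 2) * |ell e' - ell e|) / a)
    (by positivity) (by positivity)).subset
  intro γ hγ
  rw [Function.mem_support] at hγ
  have hP : PosG x y γ := by
    by_contra hn
    exact hγ (by simp [cterm, hn])
  have hne : Ψ (gpt x y T e e' γ) ≠ 0 := by
    intro h0
    exact hγ (by simp [cterm, h0])
  obtain ⟨h1, h2, h3⟩ := hΨ.supp _ hne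
  obtain ⟨p0, p1⟩ := id hP
  have hdet := zs_det x y γ
  simp only [gpt, ell_add, ell_smul] at h1 h2 h3
  refine ⟨hP, ?_, ?_⟩
  · rw [zf_rsum, abs_of_pos (by positivity), le_div_iff₀ hμ0]
    have := min_le_left (ell e) (ell e')
    have := min_le_right (ell e) (ell e')
    nlinarith
  · have hz : zf x y (rsum γ) ≤ b / μ := by
      rw [zf_rsum, le_div_iff₀ hμ0]
      have := min_le_left (ell e) (ell e')
      have := min_le_right (ell e) (ell e')
      nlinarith
    rw [le_div_iff₀ ha]
    rw [zf_rsum] at hz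
    rw [sf_rsum]
    set W0 := zf x y (grow γ 0)
    set W1 := zf x y (grow γ 1)
    set S0 := sf x y (grow γ 0)
    set S1 := sf x y (grow γ 1)
    have e3 : S0 / T * ell e + S1 / T * ell e' = (S0 * ell e + S1 * ell e') / T := by ring
    rw [e3, abs_div, abs_of_pos hT, div_le_iff₀ hT] at h3
    have key : (S0 + S1) * (W0 * ell e + W1 * ell e') =
        (W0 + W1) * (S0 * ell e + S1 * ell e') - (x ^ 2 + y ^ 2) * (ell e' - ell e) := by
      linear_combination (-(ell e' - ell e)) * hdet
    calc |S0 + S1| * a ≤ |S0 + S1| * (W0 * ell e + W1 * ell e') := by gcongr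
      _ = |(S0 + S1) * (W0 * ell e + W1 * ell e')| := by
        rw [abs_mul, abs_of_pos (by linarith : 0 < W0 * ell e + W1 * ell e')]
      _ ≤ |(W0 + W1) * (S0 * ell e + S1 * ell e')| + |(x ^ 2 + y ^ 2) * (ell e' - ell e)| := by
        rw [key]; exact abs_sub _ _
      _ ≤ _ := by
        rw [abs_mul, abs_mul, abs_of_pos hq, abs_of_pos (by positivity : 0 < W0 + W1)]
        gcongr

def Amat : SL2Z := ⟨!![1, -1; 0, 1], by simp [Matrix.det_fin_two_of]⟩
def Bmat : SL2Z := ⟨!![1, 0; -1, 1], by simp [Matrix.det_fin_two_of]⟩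

lemma Amat_z (x y : ℝ) (γ : SL2Z) : zf x y (grow (Amat * γ) 0) = zf x y (grow γ 0) - zf x y (grow γ 1) ∧
    zf x y (grow (Amat * γ) 1) = zf x y (grow γ 1) ∧
    sf x y (grow (Amat * γ) 0) = sf x y (grow γ 0) - sf x y (grow γ 1) ∧
    sf x y (grow (Amat * γ) 1) = sf x y (grow γ 1) := by
  simp only [zf_row_mul, sf_row_mul]
  simp [Amat, sub_eq_add_neg]

lemma Bmat_z (x y : ℝ) (γ : SL2Z) : zf x y (grow (Bmat * γ) 0) = zf x y (grow γ 0) ∧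
    zf x y (grow (Bmat * γ) 1) = zf x y (grow γ 1) - zf x y (grow γ 0) ∧
    sf x y (grow (Bmat * γ) 0) = sf x y (grow γ 0) ∧
    sf x y (grow (Bmat * γ) 1) = sf x y (grow γ 1) - sf x y (grow γ 0) := by
  simp only [zf_row_mul, sf_row_mul]
  simp [Bmat, sub_eq_add_neg, add_comm]

open Classical in
lemma cterm_split {x y : ℝ} (h : Irr x y) (Ψ : (ℝ × ℝ) × (ℝ × ℝ) → ℝ) (T : ℝ) (e e' : ℝ × ℝ) (γ : SL2Z) :
    cterm x y Ψ T e e' γ = cterm x y Ψ T e (e + e') (Amat * γ) + cterm x y Ψ T (e + e') e' (Bmat * γ) := by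
  obtain ⟨a1, a2, a3, a4⟩ := Amat_z x y γ
  obtain ⟨b1, b2, b3, b4⟩ := Bmat_z x y γ
  have g1 : gpt x y T e (e + e') (Amat * γ) = gpt x y T e e' γ := by
    simp only [gpt, a1, a2, a3, a4]
    ext <;> simp <;> ring
  have g2 : gpt x y T (e + e') e' (Bmat * γ) = gpt x y T e e' γ := by
    simp only [gpt, b1, b2, b3, b4]
    ext <;> simp <;> ring
  have hne : zf x y (grow γ 0) ≠ zf x y (grow γ 1) := by
    intro h0
    have h1 : zf x y (grow γ 0 - grow γ 1) = 0 := by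
      have : zf x y (grow γ 0 - grow γ 1) = zf x y (grow γ 0) - zf x y (grow γ 1) := by simp [zf]; ring
      rw [this]; linarith
    have h2 : grow γ 0 - grow γ 1 ≠ 0 := by
      intro h2
      have h3 := row_det γ
      rw [sub_eq_zero.1 h2] at h3
      linarith [mul_comm (grow γ 1).1 (grow γ 1).2]
    exact zf_ne h h2 h1
  have iA : PosG x y (Amat * γ) ↔ (0 < zf x y (grow γ 0) - zf x y (grow γ 1) ∧ 0 < zf x y (grow γ 1)) := by
    rw [PosG, a1, a2]
  have iB : PosG x y (Bmat * γ) ↔ (0 < zf x y (grow γ 0) ∧ 0 < zf x y (grow γ 1) - zf x y (grow γ 0)) := by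
    rw [PosG, b1, b2]
  simp only [cterm, g1, g2]
  rcases lt_or_gt_of_ne hne with hl | hl
  · have n1 : ¬ (0 < zf x y (grow γ 0) - zf x y (grow γ 1) ∧ 0 < zf x y (grow γ 1)) := by
      rintro ⟨h1, h2⟩; linarith
    have n2 : (0 < zf x y (grow γ 0) ∧ 0 < zf x y (grow γ 1) - zf x y (grow γ 0)) ↔
      (0 < zf x y (grow γ 0) ∧ 0 < zf x y (grow γ 1)) := by
      constructor
      · rintro ⟨h1, h2⟩; exact ⟨h1, by linarith⟩
      · rintro ⟨h1, h2⟩; exact ⟨h1, by linarith⟩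
    rw [if_neg (fun hh => n1 (iA.1 hh)), zero_add]
    exact if_congr (iB.trans n2).symm rfl rfl
  · have n1 : ¬ (0 < zf x y (grow γ 0) ∧ 0 < zf x y (grow γ 1) - zf x y (grow γ 0)) := by
      rintro ⟨h1, h2⟩; linarith
    have n2 : (0 < zf x y (grow γ 0) - zf x y (grow γ 1) ∧ 0 < zf x y (grow γ 1)) ↔
      (0 < zf x y (grow γ 0) ∧ 0 < zf x y (grow γ 1)) := by
      constructor
      · rintro ⟨h1, h2⟩; exact ⟨by linarith, h2⟩
      · rintro ⟨h1, h2⟩; exact ⟨by linarith, h2⟩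
    rw [if_neg (fun hh => n1 (iB.1 hh)), add_zero]
    exact if_congr (iA.trans n2).symm rfl rfl

lemma tsum_mulLeft (A : SL2Z) (f : SL2Z → ℝ) : ∑' γ, f (A * γ) = ∑' γ, f γ :=
  (Equiv.mulLeft A).tsum_eq f

lemma summable_mulLeft (A : SL2Z) {f : SL2Z → ℝ} (hf : Summable f) : Summable fun γ => f (A * γ) :=
  (Equiv.mulLeft A).summable_iff.2 hf

lemma cs_add {x y : ℝ} (h : Irr x y) {Ψ : (ℝ × ℝ) × (ℝ × ℝ) → ℝ} {a b B M : ℝ} (hΨ : TF Ψ a b B M)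
    {T : ℝ} (hT : 0 < T) {e e' : ℝ × ℝ} (hc : Cone e e') :
    csum x y Ψ T e e' = csum x y Ψ T e (e + e') + csum x y Ψ T (e + e') e' := by
  have s1 := cs_summable h hΨ hT hc.left
  have s2 := cs_summable h hΨ hT hc.right
  have t1 := tsum_mulLeft Amat (cterm x y Ψ T e (e + e'))
  have t2 := tsum_mulLeft Bmat (cterm x y Ψ T (e + e') e')
  have s1' := summable_mulLeft Amat s1
  have s2' := summable_mulLeft Bmat s2
  have t3 := s1'.tsum_add s2'
  rw [t1, t2] at t3
  have t4 : ∑' γ, cterm x y Ψ T e e' γ = ∑' γ, (cterm x y Ψ T e (e + e') (Amat * γ) +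
      cterm x y Ψ T (e + e') e' (Bmat * γ)) := tsum_congr fun γ => cterm_split h Ψ T e e' γ
  rw [t3] at t4
  unfold csum
  rw [t4, mul_add]

lemma cs_nonneg {x y : ℝ} {Ψ : (ℝ × ℝ) × (ℝ × ℝ) → ℝ} {a b B M : ℝ} (hΨ : TF Ψ a b B M)
    {T : ℝ} (hT : 0 < T) (e e' : ℝ × ℝ) : 0 ≤ csum x y Ψ T e e' := by
  apply mul_nonneg (by positivity)
  apply tsum_nonneg
  intro γ
  simp only [cterm]
  split_ifs
  · exact hΨ.nonneg _
  · exact le_rfl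

/-- plateau function: one on `[c,d]`, zero at distance `δ` -/
def plat (δ c d t : ℝ) : ℝ := max 0 (min 1 (1 + (min (t - c) (d - t)) / δ))

lemma plat_cont (δ c d : ℝ) : Continuous (plat δ c d) := by
  unfold plat; fun_prop

lemma plat_nonneg (δ c d t : ℝ) : 0 ≤ plat δ c d t := le_max_left _ _
lemma plat_le (δ c d t : ℝ) : plat δ c d t ≤ 1 := max_le zero_le_one (min_le_left _ _)

lemma plat_one {δ c d t : ℝ} (hδ : 0 < δ) (h1 : c ≤ t) (h2 : t ≤ d) : plat δ c d t = 1 := by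
  have : 0 ≤ (min (t - c) (d - t)) / δ := by
    apply div_nonneg _ hδ.le
    exact le_min (by linarith) (by linarith)
  unfold plat
  rw [min_eq_left (by linarith), max_eq_right zero_le_one]

lemma plat_supp {δ c d t : ℝ} (hδ : 0 < δ) (h : plat δ c d t ≠ 0) : c - δ ≤ t ∧ t ≤ d + δ := by
  by_contra hn
  apply h
  unfold plat
  apply max_eq_left
  refine (min_le_right _ _).trans ?_
  have : min (t - c) (d - t) ≤ -δ := by
    rcases not_and_or.1 hn with h1 | h1
    · exact (min_le_left _ _).trans (by linarith)
    · exact (min_le_right _ _).trans (by linarith)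
  have h2 : (min (t - c) (d - t)) / δ ≤ -1 := by
    rw [div_le_iff₀ hδ]; linarith
  linarith

def F0 (a b B : ℝ) (p : ℝ × ℝ) : ℝ := plat (a / 4) (a / 2) (2 * b) p.1 * plat 1 (-(2 * B + 1)) (2 * B + 1) p.2

lemma F0_cont (a b B : ℝ) : Continuous (F0 a b B) :=
  ((plat_cont _ _ _).comp continuous_fst).mul ((plat_cont _ _ _).comp continuous_snd)

lemma F0_nonneg (a b B : ℝ) (p : ℝ × ℝ) : 0 ≤ F0 a b B p := mul_nonneg (plat_nonneg _ _ _ _) (plat_nonneg _ _ _ _)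

lemma F0_one {a b B : ℝ} (ha : 0 < a) {p : ℝ × ℝ} (h1 : a / 2 ≤ p.1) (h2 : p.1 ≤ 2 * b)
    (h3 : |p.2| ≤ 2 * B + 1) : F0 a b B p = 1 := by
  rw [abs_le] at h3
  unfold F0
  rw [plat_one (by positivity) h1 h2, plat_one one_pos h3.1 h3.2, one_mul]

lemma F0_supp {a b B : ℝ} (ha : 0 < a) : SliceSupp (F0 a b B) (a / 4) (2 * b + a / 4) (2 * B + 2) := by
  intro p hp
  have h1 := plat_supp (by positivity) (left_ne_zero_of_mul hp)
  have h2 := plat_supp one_pos (right_ne_zero_of_mul hp)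
  refine ⟨by linarith [h1.1], h1.2, ?_⟩
  rw [abs_le]; constructor <;> linarith [h2.1, h2.2]

def pl (t : ℝ) : ℝ × ℝ := (1 - t, t)
def lam (e : ℝ × ℝ) : ℝ := e.2 / ell e
lemma pl_lam {e : ℝ × ℝ} (h : 0 < ell e) : ell e • pl (lam e) = e := by
  simp only [pl, lam]
  have : e.1 + e.2 ≠ 0 := h.ne'
  ext <;> simp [ell] <;> field_simp
  ring
lemma ell_pl (t : ℝ) : ell (pl t) = 1 := by simp [ell, pl]

def kk (Ψ : (ℝ × ℝ) × (ℝ × ℝ) → ℝ) (t : ℝ) : ℝ := ∫ p : ℝ × ℝ, Ψ (p.1 • pl t, p.2 • pl t)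

lemma kk_slice {Ψ : (ℝ × ℝ) × (ℝ × ℝ) → ℝ} {a b B M : ℝ} (hΨ : TF Ψ a b B M) (t : ℝ) :
    SliceSupp (fun p : ℝ × ℝ => Ψ (p.1 • pl t, p.2 • pl t)) a b B := by
  intro p hp
  have := hΨ.supp _ hp
  simpa [ell_smul, ell_pl] using this

set_option maxHeartbeats 1000000 in
lemma good_point {Ψ : (ℝ × ℝ) × (ℝ × ℝ) → ℝ} {a b B M : ℝ} (hΨ : TF Ψ a b B M) (x y : ℝ) {η : ℝ} (hη : 0 < η) :
    ∃ ε : ℝ, 0 < ε ∧ ε ≤ 1 / 4 ∧ ∀ e e', Cone e e' → |e'.1 - e.1| ≤ ε * ell e →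
      |e'.2 - e.2| ≤ ε * ell e → ∀ᶠ T in atTop, ∀ γ, PosG x y γ →
      Ψ (zf x y (rsum γ) • e, (sf x y (rsum γ) / T) • e) -
        η * F0 a b B (ell e * zf x y (rsum γ), ell e * (sf x y (rsum γ) / T)) ≤ Ψ (gpt x y T e e' γ) := by
  have ha := hΨ.ha
  have hb := hΨ.hb
  have hB := hΨ.hB
  obtain ⟨δ, hδ, huc⟩ := Metric.uniformContinuous_iff.1 hΨ.uc η hη
  set Y := 2 * b + (2 * B + 2) + 1 with hY
  have hY0 : 0 < Y := by positivity
  refine ⟨min (1 / 4) (δ / (2 * Y)), by positivity, min_le_left _ _, ?_⟩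
  set ε := min (1 / 4) (δ / (2 * Y)) with hε
  have hε4 : ε ≤ 1 / 4 := min_le_left _ _
  have hε0 : 0 < ε := by positivity
  have hεδ : ε * Y < δ := by
    have : ε ≤ δ / (2 * Y) := min_le_right _ _
    rw [le_div_iff₀ (by positivity)] at this
    nlinarith
  intro e e' hc hg1 hg2
  have hp := hc.pos
  set q := x ^ 2 + y ^ 2 with hq
  have hq0 : 0 ≤ q := by positivity
  filter_upwards [eventually_ge_atTop 1, eventually_ge_atTop (q * ell e ^ 2 * 2 / a)] with T hT1 hT2 γ hγ
  have hT0 : 0 < T := by linarith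
  by_cases hF : Ψ (zf x y (rsum γ) • e, (sf x y (rsum γ) / T) • e) ≤ Ψ (gpt x y T e e' γ)
  · have := mul_nonneg hη.le (F0_nonneg a b B (ell e * zf x y (rsum γ), ell e * (sf x y (rsum γ) / T)))
    linarith
  push Not at hF
  have hne : Ψ (zf x y (rsum γ) • e, (sf x y (rsum γ) / T) • e) ≠ 0 := by
    have := hΨ.nonneg (gpt x y T e e' γ)
    intro h0; linarith
  obtain ⟨s1, s2, s3⟩ := hΨ.supp _ hne
  simp only [ell_smul] at s1 s2 s3
  obtain ⟨p0, p1⟩ := hγ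
  have hdet := zs_det x y γ
  have hone : F0 a b B (ell e * zf x y (rsum γ), ell e * (sf x y (rsum γ) / T)) = 1 := by
    apply F0_one ha
    · simp only; linarith
    · simp only; linarith
    · simp only; rw [mul_comm]; linarith
  rw [hone, mul_one]
  rw [zf_rsum] at *
  rw [sf_rsum] at *
  set W0 := zf x y (grow γ 0) with hW0
  set W1 := zf x y (grow γ 1) with hW1
  set S0 := sf x y (grow γ 0) with hS0
  set S1 := sf x y (grow γ 1) with hS1
  -- bound on S1/T
  have hz : 0 < W0 + W1 := by positivity
  have hS1e : S1 = (W1 * (S0 + S1) + q) / (W0 + W1) := by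
    rw [eq_div_iff hz.ne']; linear_combination hdet
  have b1 : |S1 / T| * ell e ≤ B + 1 := by
    have e1 : |S1| * (W0 + W1) ≤ (W0 + W1) * |S0 + S1| + q := by
      have : S1 * (W0 + W1) = W1 * (S0 + S1) + q := by linear_combination hdet
      rw [← abs_of_pos hz, ← abs_mul, this]
      refine (abs_add_le _ _).trans ?_
      rw [abs_mul, abs_of_pos p1, abs_of_nonneg hq0, abs_of_pos hz]
      gcongr
      linarith
    rw [abs_div, abs_of_pos hT0]
    simp only [abs_mul, abs_div, abs_of_pos hT0, abs_of_pos hp] at s3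
    rw [div_mul_eq_mul_div, div_le_iff₀ hT0] at s3 ⊢
    rw [div_le_iff₀ ha] at hT2
    have e2 : (|S1| * ell e) * (W0 + W1) ≤ ((B + 1) * T) * (W0 + W1) := by
      have e3 : q * ell e ≤ T * (W0 + W1) := by
        have : (q * ell e) * ell e ≤ (T * (W0 + W1)) * ell e := by nlinarith
        exact le_of_mul_le_mul_right this hp
      have e4 : (|S0 + S1| * ell e) * (W0 + W1) ≤ (B * T) * (W0 + W1) := by gcongr
      have e5 : |S1| * (W0 + W1) * ell e ≤ ((W0 + W1) * |S0 + S1| + q) * ell e := by gcongr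
      nlinarith
    exact le_of_mul_le_mul_right e2 hz
  have hdist : dist ((W0 + W1) • e, ((S0 + S1) / T) • e) (gpt x y T e e' γ) < δ := by
    have c1 : ∀ u u' : ℝ, |u' - u| ≤ ε * ell e → |(W0 + W1) * u - (W0 * u + W1 * u')| < δ := by
      intro u u' huu
      have : (W0 + W1) * u - (W0 * u + W1 * u') = -(W1 * (u' - u)) := by ring
      rw [this, abs_neg, abs_mul, abs_of_pos p1]
      calc W1 * |u' - u| ≤ W1 * (ε * ell e) := by gcongr
        _ = ε * (W1 * ell e) := by ring
        _ ≤ ε * Y := by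
          apply mul_le_mul_of_nonneg_left _ hε0.le
          have := mul_pos p0 hp
          linarith
        _ < δ := hεδ
    have c2 : ∀ u u' : ℝ, |u' - u| ≤ ε * ell e → |(S0 + S1) / T * u - (S0 / T * u + S1 / T * u')| < δ := by
      intro u u' huu
      have : (S0 + S1) / T * u - (S0 / T * u + S1 / T * u') = -(S1 / T * (u' - u)) := by ring
      rw [this, abs_neg, abs_mul]
      calc |S1 / T| * |u' - u| ≤ |S1 / T| * (ε * ell e) := by gcongr
        _ = ε * (|S1 / T| * ell e) := by ring
        _ ≤ ε * Y := by
          apply mul_le_mul_of_nonneg_left _ hε0.le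
          linarith
        _ < δ := hεδ
    simp only [gpt, Prod.dist_eq, Real.dist_eq, Prod.smul_fst, Prod.smul_snd, Prod.fst_add, Prod.snd_add,
      smul_eq_mul, max_lt_iff]
    exact ⟨⟨c1 _ _ hg1, c1 _ _ hg2⟩, c2 _ _ hg1, c2 _ _ hg2⟩
  have := huc hdist
  rw [Real.dist_eq, abs_lt] at this
  linarith [this.2]

lemma good_lower {x y : ℝ} (h : Irr x y) {Ψ : (ℝ × ℝ) × (ℝ × ℝ) → ℝ} {a b B M : ℝ} (hΨ : TF Ψ a b B M)
    {η : ℝ} (hη : 0 < η) :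
    ∃ ε : ℝ, 0 < ε ∧ ε ≤ 1 / 4 ∧ ∀ e e', Cone e e' → |e'.1 - e.1| ≤ ε * ell e →
      |e'.2 - e.2| ≤ ε * ell e → ∀ᶠ T in atTop,
      (kap / (x ^ 2 + y ^ 2) * (kk Ψ (lam e) - η * ∫ p, F0 a b B p) - η) / ell e ^ 2 ≤ csum x y Ψ T e e' := by
  have ha := hΨ.ha
  have hb := hΨ.hb
  have hB := hΨ.hB
  obtain ⟨ε, hε, hε4, H⟩ := good_point hΨ x y hη
  refine ⟨ε, hε, hε4, fun e e' hc hg1 hg2 => ?_⟩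
  have hp := hc.pos
  have hΨc := hΨ.uc.continuous
  have hF0c := F0_cont a b B
  set G : ℝ × ℝ → ℝ := fun p => Ψ (p.1 • pl (lam e), p.2 • pl (lam e)) - η * F0 a b B p with hG
  have hΦS := kk_slice hΨ (lam e)
  have hF0S : SliceSupp (F0 a b B) (a / 4) (2 * b + a / 4) (2 * B + 2) := F0_supp ha
  have hGS : SliceSupp G (a / 4) (2 * b + a / 4) (2 * B + 2) := by
    intro p hp
    by_cases h0 : F0 a b B p = 0
    · have : Ψ (p.1 • pl (lam e), p.2 • pl (lam e)) ≠ 0 := by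
        intro h1; apply hp; simp [hG, h0, h1]
      obtain ⟨h1, h2, h3⟩ := hΦS p this
      exact ⟨by linarith, by linarith, by linarith⟩
    · exact hF0S p h0
  have hGc : Continuous G := by
    simp only [hG]; fun_prop
  set F1 : ℝ × ℝ → ℝ := fun p => G (ell e • p) with hF1
  have hF1c : Continuous F1 := by simp only [hF1]; fun_prop
  have hF1S : SliceSupp F1 (a / 4 / ell e) ((2 * b + a / 4) / ell e) ((2 * B + 2) / ell e) := by
    intro p hpp
    obtain ⟨h1, h2, h3⟩ := hGS _ hpp
    simp only [Prod.smul_fst, Prod.smul_snd, smul_eq_mul, abs_mul, abs_of_pos hp] at h1 h2 h3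
    refine ⟨?_, ?_, ?_⟩
    · rw [div_le_iff₀ hp]; linarith
    · rw [le_div_iff₀ hp]; linarith
    · rw [le_div_iff₀ hp]; linarith
  have hlim := gam_equi h (by positivity) (by positivity) (by positivity) hF1c hF1S
  have hintg : ∫ p, F1 p = (kk Ψ (lam e) - η * ∫ p, F0 a b B p) / ell e ^ 2 := by
    simp only [hF1]
    rw [Measure.integral_comp_smul]
    simp only [Module.finrank_prod, Module.finrank_self, Nat.reduceAdd, smul_eq_mul, abs_inv, abs_pow,
      abs_of_pos hp]
    rw [div_eq_inv_mul]
    congr 1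
    simp only [hG, kk]
    rw [integral_sub, integral_const_mul]
    · exact Continuous.integrable_of_hasCompactSupport (by fun_prop) (hΦS.box ha).hasCompactSupport
    · exact (Continuous.integrable_of_hasCompactSupport hF0c (hF0S.box (by positivity)).hasCompactSupport).const_mul _
  have hlt : (kap / (x ^ 2 + y ^ 2) * (kk Ψ (lam e) - η * ∫ p, F0 a b B p) - η) / ell e ^ 2 <
      kap / (x ^ 2 + y ^ 2) * ∫ p, F1 p := by
    rw [hintg, ← mul_div_assoc]
    gcongr
    linarith
  filter_upwards [hlim.eventually_const_lt hlt, H e e' hc hg1 hg2, eventually_ge_atTop 1] with T h1 h2 hT1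
  have hT0 : 0 < T := by linarith
  refine h1.le.trans ?_
  unfold csum
  apply mul_le_mul_of_nonneg_left _ (by positivity)
  apply Summable.tsum_le_tsum _ _ (cs_summable h hΨ hT0 hc)
  · intro γ
    unfold cterm
    split_ifs with hP
    · refine le_trans (le_of_eq ?_) (h2 γ hP)
      simp only [hF1, hG, Prod.smul_mk, smul_eq_mul]
      have hz : ∀ c : ℝ, (ell e * c) • pl (lam e) = c • e := by
        intro c
        conv_rhs => rw [← pl_lam hp]
        rw [smul_smul, mul_comm]
      rw [hz, hz]
    · exact le_rfl
  · apply summable_of_hasFiniteSupport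
    apply (pos_finite h ((2 * b + a / 4) / ell e) ((2 * B + 2) / ell e * T) (by positivity) (by positivity)).subset
    intro γ hγ
    rw [Function.mem_support] at hγ
    have hP : PosG x y γ := by
      by_contra hn
      exact hγ (by simp [hn])
    have hne : F1 (zf x y (rsum γ), sf x y (rsum γ) / T) ≠ 0 := by
      intro h0
      exact hγ (by simp [h0])
    obtain ⟨g1, g2, g3⟩ := hF1S _ hne
    simp only [abs_div, abs_of_pos hT0] at g1 g2 g3
    have : 0 < a / 4 / ell e := by positivity
    refine ⟨hP, ?_, ?_⟩
    · rw [abs_of_pos (by linarith)]; exact g2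
    · rwa [div_le_iff₀ hT0] at g3

lemma kk_cont {Ψ : (ℝ × ℝ) × (ℝ × ℝ) → ℝ} {a b B M : ℝ} (hΨ : TF Ψ a b B M) : Continuous (kk Ψ) := by
  have hΨc := hΨ.uc.continuous
  unfold kk
  apply continuous_of_dominated (bound := (Set.Icc a b ×ˢ Set.Icc (-B) B).indicator (fun _ => M))
  · intro t
    have : Continuous fun p : ℝ × ℝ => Ψ (p.1 • pl t, p.2 • pl t) := by fun_prop
    exact this.aestronglyMeasurable
  · intro t
    refine Eventually.of_forall fun p => ?_
    rw [Real.norm_eq_abs, abs_of_nonneg (hΨ.nonneg _)]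
    by_cases hp : p ∈ Set.Icc a b ×ˢ Set.Icc (-B) B
    · rw [Set.indicator_of_mem hp]; exact hΨ.le _
    · rw [Set.indicator_of_notMem hp]
      apply le_of_eq
      by_contra hn
      apply hp
      obtain ⟨h1, h2, h3⟩ := kk_slice hΨ t p hn
      exact ⟨⟨h1, h2⟩, abs_le.1 h3⟩
  · apply IntegrableOn.integrable_indicator
    · exact integrableOn_const (hs := (isCompact_Icc.prod isCompact_Icc).measure_ne_top) (hC := enorm_ne_top)
    · exact measurableSet_Icc.prod measurableSet_Icc
  · refine Eventually.of_forall fun p => ?_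
    unfold pl
    fun_prop

lemma kk_nonneg {Ψ : (ℝ × ℝ) × (ℝ × ℝ) → ℝ} {a b B M : ℝ} (hΨ : TF Ψ a b B M) (t : ℝ) : 0 ≤ kk Ψ t :=
  integral_nonneg fun p => hΨ.nonneg _

lemma lam_add {e e' : ℝ × ℝ} (h : Cone e e') : lam e' - lam e = ms e e' := by
  have h1 := h.pos
  have h2 := h.pos'
  unfold lam ms
  rw [div_sub_div _ _ h2.ne' h1.ne']
  rw [mul_comm (ell e) (ell e')]
  congr 1
  have := h.2.2.2.2
  unfold ell; linarith

lemma lam_mem {e e' : ℝ × ℝ} (h : Cone e e') : lam e ∈ Set.Icc (0 : ℝ) 1 := by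
  have h1 := h.pos
  unfold lam
  refine ⟨div_nonneg h.2.1 h1.le, ?_⟩
  rw [div_le_one h1]
  unfold ell; linarith [h.1]

lemma lam_mem' {e e' : ℝ × ℝ} (h : Cone e e') : lam e' ∈ Set.Icc (0 : ℝ) 1 := by
  have h1 := h.pos'
  unfold lam
  refine ⟨div_nonneg h.2.2.2.1 h1.le, ?_⟩
  rw [div_le_one h1]
  unfold ell; linarith [h.2.2.1]

lemma lower {x y : ℝ} (h : Irr x y) {Ψ : (ℝ × ℝ) × (ℝ × ℝ) → ℝ} {a b B M : ℝ} (hΨ : TF Ψ a b B M)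
    {e e' : ℝ × ℝ} (hc : Cone e e') {η : ℝ} (hη : 0 < η) : ∀ᶠ T in atTop,
    kap / (x ^ 2 + y ^ 2) * (∫ t in (lam e)..(lam e'), kk Ψ t) - csum x y Ψ T e e' ≤ η * ms e e' := by
  have hq := h.q_pos
  have hk := kap_pos
  set C := kap / (x ^ 2 + y ^ 2) with hC
  have hC0 : 0 < C := by positivity
  have hkc := kk_cont hΨ
  have hI : ∀ s t, IntervalIntegrable (kk Ψ) volume s t := fun s t => hkc.intervalIntegrable s t
  obtain ⟨X, hX⟩ := (isCompact_Icc (a := (0 : ℝ)) (b := 1)).exists_bound_of_continuousOn hkc.continuousOn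
  simp only [Real.norm_eq_abs] at hX
  have hX0 : 0 ≤ X := (abs_nonneg _).trans (hX 0 (by simp))
  have hnb : ∀ {e e'}, Cone e e' → ∀ {c : ℝ}, (∀ t, lam e ≤ t → t ≤ lam e' → kk Ψ t ≤ c) →
      (∫ t in (lam e)..(lam e'), kk Ψ t) ≤ c * ms e e' := by
    intro e e' hc c hcc
    have hle : lam e ≤ lam e' := by linarith [lam_add hc, hc.ms_pos]
    have := intervalIntegral.integral_mono_on hle (hI _ _) (intervalIntegrable_const (c := c))
      (fun t ht => hcc t ht.1 ht.2)
    rw [intervalIntegral.integral_const, lam_add hc, smul_eq_mul, mul_comm] at this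
    exact this
  refine farey_main (Δ := fun T e e' => C * (∫ t in (lam e)..(lam e'), kk Ψ t) - csum x y Ψ T e e')
    (A := C * X) ?_ ?_ ?_ hc hη
  · intro e e' hc
    filter_upwards [eventually_gt_atTop 0] with T hT
    rw [cs_add h hΨ hT hc, ← intervalIntegral.integral_add_adjacent_intervals (hI (lam e) (lam (e + e'))) (hI _ _)]
    linarith
  · intro e e' hc
    filter_upwards [eventually_gt_atTop 0] with T hT
    have h1 := cs_nonneg (x := x) (y := y) hΨ hT e e'
    have h2 := hnb hc (c := X) (fun t ht1 ht2 => (le_abs_self _).trans (hX t ⟨(lam_mem hc).1.trans ht1, ht2.trans (lam_mem' hc).2⟩))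
    have h3 := mul_le_mul_of_nonneg_left h2 hC0.le
    linarith
  · intro η hη
    set I0 := ∫ p, F0 a b B p with hI0
    have hI00 : 0 ≤ I0 := integral_nonneg fun p => F0_nonneg a b B p
    set Y := C + 2 * (C * I0 + 1) + 2 * C * X + 1 with hY
    have hY0 : 0 < Y := by positivity
    set η1 := η / Y with hη1
    have hη10 : 0 < η1 := by positivity
    have huc := isCompact_Icc (a := (0 : ℝ)) (b := 1) |>.uniformContinuousOn_of_continuous hkc.continuousOn
    rw [Metric.uniformContinuousOn_iff] at huc
    obtain ⟨δ, hδ, huc⟩ := huc η1 hη10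
    obtain ⟨ε1, hε1, hε14, HL⟩ := good_lower h hΨ hη10
    set ε := min ε1 (min (δ / 4) η1) with hε
    have hε0 : 0 < ε := by positivity
    have i1 : ε ≤ ε1 := min_le_left _ _
    have i2 : ε ≤ δ / 4 := (min_le_right _ _).trans (min_le_left _ _)
    have i3 : ε ≤ η1 := (min_le_right _ _).trans (min_le_right _ _)
    refine ⟨ε, hε0, fun e e' hc hg1 hg2 => ?_⟩
    have hp := hc.pos
    have hp' := hc.pos'
    filter_upwards [HL e e' hc (hg1.trans (by gcongr)) (hg2.trans (by gcongr))] with T hT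
    have hl1 : ell e' - ell e ≤ 2 * ε * ell e := by
      rw [abs_le] at hg1 hg2; unfold ell at *; linarith
    have hl2 : -(2 * ε * ell e) ≤ ell e' - ell e := by
      rw [abs_le] at hg1 hg2; unfold ell at *; linarith
    have hlen : ms e e' < δ := by
      rw [← lam_add hc]
      have e1 : lam e' * ell e' = e'.2 := by unfold lam; field_simp
      have e2 : lam e * ell e = e.2 := by unfold lam; field_simp
      have m1 := lam_mem' hc
      have e3 : (lam e' - lam e) * ell e ≤ (3 * ε) * ell e := by
        have : (lam e' - lam e) * ell e = (e'.2 - e.2) - lam e' * (ell e' - ell e) := by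
          linear_combination e1 - e2
        rw [this]
        rw [abs_le] at hg2
        have : -(lam e' * (ell e' - ell e)) ≤ 2 * ε * ell e := by
          have : 0 ≤ 2 * ε * ell e := by positivity
          nlinarith [m1.1, m1.2]
        linarith [hg2.2]
      have := le_of_mul_le_mul_right e3 hp
      linarith
    have hV := hnb hc (c := kk Ψ (lam e) + η1) (fun t ht1 ht2 => by
      have hd := huc t ⟨(lam_mem hc).1.trans ht1, ht2.trans (lam_mem' hc).2⟩ (lam e) (lam_mem hc) (by
        rw [Real.dist_eq, abs_of_nonneg (by linarith)]
        linarith [lam_add hc])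
      rw [Real.dist_eq, abs_lt] at hd
      linarith [hd.2])
    have hV2 := mul_le_mul_of_nonneg_left hV hC0.le
    set m := ms e e' with hm
    have hm0 : 0 < m := hc.ms_pos
    set k := kk Ψ (lam e)
    have hk0 : 0 ≤ k := kk_nonneg hΨ _
    have hkX : k ≤ X := (le_abs_self _).trans (hX _ (lam_mem hc))
    have hinv : 1 / ell e ^ 2 = m * (ell e' / ell e) := by
      rw [hm, ms]; field_simp
    have r1 : ell e' / ell e ≤ 1 + 2 * ε := by rw [div_le_iff₀ hp]; linarith
    have r2 : 1 - 2 * ε ≤ ell e' / ell e := by rw [le_div_iff₀ hp]; linarith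
    rw [div_eq_mul_one_div, hinv] at hT
    set ρ := ell e' / ell e
    have hρ2 : ρ ≤ 2 := by linarith
    have hρ0 : 0 ≤ ρ := by positivity
    have fin : C * ((k + η1) * m) - (C * (k - η1 * I0) - η1) * (m * ρ) ≤ η * m := by
      have e1 : C * ((k + η1) * m) - (C * (k - η1 * I0) - η1) * (m * ρ)
        = m * (C * k * (1 - ρ) + C * η1 + (C * I0 + 1) * η1 * ρ) := by ring
      have e2 : η = η1 * Y := by rw [hη1]; field_simp
      rw [e1, e2, mul_comm (η1 * Y)]
      apply mul_le_mul_of_nonneg_left _ hm0.le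
      have f1 : C * k * (1 - ρ) ≤ C * X * (2 * η1) := by
        have g1 : C * k * (1 - ρ) ≤ C * k * (2 * η1) := by
          apply mul_le_mul_of_nonneg_left _ (by positivity); linarith
        have g2 : C * k * (2 * η1) ≤ C * X * (2 * η1) := by gcongr
        linarith
      have f2 : (C * I0 + 1) * η1 * ρ ≤ (C * I0 + 1) * η1 * 2 := by gcongr
      rw [hY]
      nlinarith
    linarith

lemma std_cone : Cone (1, 0) (0, 1) := by simp [Cone]

def GG (M a b B : ℝ) (p : (ℝ × ℝ) × (ℝ × ℝ)) : ℝ := M * F0 a b B (ell p.1, ell p.2)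

lemma GG_uc {M a b B : ℝ} (ha : 0 < a) : UniformContinuous (GG M a b B) := by
  have h1 : UniformContinuous (F0 a b B) :=
    ((F0_supp ha).box (by positivity)).hasCompactSupport.uniformContinuous_of_continuous (F0_cont a b B)
  have h2 : UniformContinuous (fun p : (ℝ × ℝ) × (ℝ × ℝ) => (ell p.1, ell p.2)) := by
    unfold ell
    apply UniformContinuous.prodMk
    · exact (uniformContinuous_fst.comp uniformContinuous_fst).add (uniformContinuous_snd.comp uniformContinuous_fst)
    · exact (uniformContinuous_fst.comp uniformContinuous_snd).add (uniformContinuous_snd.comp uniformContinuous_snd)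
  have h3 := h1.comp h2
  have h4 : UniformContinuous (fun u : ℝ => M * u) := uniformContinuous_const_smul M
  exact h4.comp h3

lemma GG_TF {Ψ : (ℝ × ℝ) × (ℝ × ℝ) → ℝ} {a b B M : ℝ} (hΨ : TF Ψ a b B M) :
    TF (GG M a b B) (a / 4) (2 * b + a / 4) (2 * B + 2) M where
  uc := GG_uc hΨ.ha
  nonneg p := mul_nonneg ((hΨ.nonneg 0).trans (hΨ.le 0)) (F0_nonneg _ _ _ _)
  le p := by
    have h1 : F0 a b B (ell p.1, ell p.2) ≤ 1 := mul_le_one₀ (plat_le _ _ _ _) (plat_nonneg _ _ _ _) (plat_le _ _ _ _)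
    have h2 := (hΨ.nonneg 0).trans (hΨ.le 0)
    unfold GG
    nlinarith
  supp p hp := F0_supp hΨ.ha _ (right_ne_zero_of_mul hp)
  ha := by have := hΨ.ha; positivity
  hb := by have := hΨ.ha; have := hΨ.hb; positivity
  hB := by have := hΨ.hB; positivity

lemma GG_ge {Ψ : (ℝ × ℝ) × (ℝ × ℝ) → ℝ} {a b B M : ℝ} (hΨ : TF Ψ a b B M) (p) : Ψ p ≤ GG M a b B p := by
  by_cases h0 : Ψ p = 0
  · rw [h0]; exact (GG_TF hΨ).nonneg p
  · obtain ⟨h1, h2, h3⟩ := hΨ.supp p h0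
    have ha := hΨ.ha
    have hb := hΨ.hb
    have hB := hΨ.hB
    unfold GG
    rw [F0_one ha, mul_one]
    · exact hΨ.le p
    · simp only; linarith
    · simp only; linarith
    · simp only; linarith

lemma diff_TF {Ψ : (ℝ × ℝ) × (ℝ × ℝ) → ℝ} {a b B M : ℝ} (hΨ : TF Ψ a b B M) :
    TF (fun p => GG M a b B p - Ψ p) (a / 4) (2 * b + a / 4) (2 * B + 2) M where
  uc := (GG_uc hΨ.ha).sub hΨ.uc
  nonneg p := sub_nonneg.2 (GG_ge hΨ p)
  le p := by linarith [(GG_TF hΨ).le p, hΨ.nonneg p]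
  supp p hp := by
    have := GG_ge hΨ p
    have h1 := hΨ.nonneg p
    apply (GG_TF hΨ).supp p
    intro h0
    apply hp
    linarith
  ha := (GG_TF hΨ).ha
  hb := (GG_TF hΨ).hb
  hB := (GG_TF hΨ).hB

lemma kk_int {Ψ : (ℝ × ℝ) × (ℝ × ℝ) → ℝ} {a b B M : ℝ} (hΨ : TF Ψ a b B M) (t : ℝ) :
    Integrable fun p : ℝ × ℝ => Ψ (p.1 • pl t, p.2 • pl t) := by
  have := hΨ.uc.continuous
  exact Continuous.integrable_of_hasCompactSupport (by fun_prop) ((kk_slice hΨ t).box hΨ.ha).hasCompactSupport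

lemma GG_lim {x y : ℝ} (h : Irr x y) {Ψ : (ℝ × ℝ) × (ℝ × ℝ) → ℝ} {a b B M : ℝ} (hΨ : TF Ψ a b B M) :
    Tendsto (fun T => csum x y (GG M a b B) T (1, 0) (0, 1)) atTop
      (𝓝 (kap / (x ^ 2 + y ^ 2) * ∫ t in (0 : ℝ)..1, kk (GG M a b B) t)) := by
  have ha := hΨ.ha
  have hb := hΨ.hb
  have hB := hΨ.hB
  have e1 : ∀ t, kk (GG M a b B) t = ∫ p, M * F0 a b B p := by
    intro t
    simp only [kk, GG, ell_smul, ell_pl, mul_one]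
  simp only [e1, intervalIntegral.integral_const, sub_zero, one_smul]
  have := gam_equi h (F := fun p => M * F0 a b B p) (a := a / 4) (b := 2 * b + a / 4) (B := 2 * B + 2)
    (by positivity) (by positivity) (by positivity)
    ((F0_cont a b B).const_mul M) (fun p hp => F0_supp ha _ (right_ne_zero_of_mul hp))
  refine this.congr fun T => ?_
  unfold csum cterm
  congr 1
  apply tsum_congr
  intro γ
  congr 1
  simp [GG, gpt, ell, zf_rsum, sf_rsum, add_div]

lemma std_limit {x y : ℝ} (h : Irr x y) {Ψ : (ℝ × ℝ) × (ℝ × ℝ) → ℝ} {a b B M : ℝ} (hΨ : TF Ψ a b B M) :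
    Tendsto (fun T => csum x y Ψ T (1, 0) (0, 1)) atTop
      (𝓝 (kap / (x ^ 2 + y ^ 2) * ∫ t in (0 : ℝ)..1, kk Ψ t)) := by
  have l0 : lam (1, 0) = 0 := by simp [lam]
  have l1 : lam (0, 1) = 1 := by simp [lam, ell]
  have m1 : ms (1, 0) (0, 1) = 1 := by simp [ms, ell]
  have hG := GG_lim h hΨ
  rw [Metric.tendsto_nhds] at hG ⊢
  intro ε hε
  have low1 := lower h hΨ std_cone (η := ε / 2) (by positivity)
  have low2 := lower h (diff_TF hΨ) std_cone (η := ε / 4) (by positivity)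
  rw [l0, l1, m1] at low1 low2
  have hkk : ∀ t, kk (fun p => GG M a b B p - Ψ p) t = kk (GG M a b B) t - kk Ψ t := by
    intro t
    unfold kk
    rw [integral_sub (kk_int (GG_TF hΨ) t) (kk_int hΨ t)]
  simp only [hkk] at low2
  rw [intervalIntegral.integral_sub ((kk_cont (GG_TF hΨ)).intervalIntegrable _ _) ((kk_cont hΨ).intervalIntegrable _ _)] at low2
  filter_upwards [low1, low2, hG (ε / 4) (by positivity), eventually_gt_atTop 0] with T h1 h2 h3 hT
  have hcs : csum x y (fun p => GG M a b B p - Ψ p) T (1, 0) (0, 1)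
      = csum x y (GG M a b B) T (1, 0) (0, 1) - csum x y Ψ T (1, 0) (0, 1) := by
    unfold csum
    rw [← mul_sub, ← (cs_summable h (GG_TF hΨ) hT std_cone).tsum_sub (cs_summable h hΨ hT std_cone)]
    congr 1
    apply tsum_congr
    intro γ
    unfold cterm
    split_ifs <;> simp
  rw [hcs] at h2
  rw [Real.dist_eq, abs_lt] at h3 ⊢
  rw [mul_sub] at h2
  constructor <;> linarith [h3.1, h3.2]

def nrm (p : ℝ × ℝ) : ℝ := Real.sqrt (p.1 ^ 2 + p.2 ^ 2)

lemma nrm_cont : Continuous nrm := by unfold nrm; fun_prop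
lemma nrm_nonneg (p : ℝ × ℝ) : 0 ≤ nrm p := Real.sqrt_nonneg _
lemma nrm_sq (p : ℝ × ℝ) : nrm p ^ 2 = p.1 ^ 2 + p.2 ^ 2 := Real.sq_sqrt (by positivity)
lemma nrm_smul (c : ℝ) (p : ℝ × ℝ) : nrm (c • p) = |c| * nrm p := by
  unfold nrm
  rw [← Real.sqrt_sq_eq_abs, ← Real.sqrt_mul (sq_nonneg c)]
  congr 1
  simp; ring
lemma fst_le_nrm (p : ℝ × ℝ) : |p.1| ≤ nrm p :=
  Real.abs_le_sqrt (by nlinarith [sq_nonneg p.2])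
lemma snd_le_nrm (p : ℝ × ℝ) : |p.2| ≤ nrm p :=
  Real.abs_le_sqrt (by nlinarith [sq_nonneg p.1])
lemma ell_le_nrm (p : ℝ × ℝ) : |ell p| ≤ 2 * nrm p := by
  have := abs_add_le p.1 p.2
  have := fst_le_nrm p
  have := snd_le_nrm p
  simp only [ell]; linarith
lemma nrm_le_ell {p : ℝ × ℝ} (h0 : 0 ≤ p.1) (h1 : 0 ≤ p.2) : nrm p ≤ ell p := by
  unfold nrm ell
  apply Real.sqrt_le_iff.2 ⟨by positivity, by nlinarith [mul_nonneg h0 h1]⟩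
lemma nrm_pl_pos (t : ℝ) : 0 < nrm (pl t) := by
  unfold nrm
  apply Real.sqrt_pos.2
  simp only [pl]
  nlinarith [sq_nonneg (1 - 2 * t)]

structure QF (φ : ℝ × ℝ → ℝ) (ρ R : ℝ) : Prop where
  cont : Continuous φ
  nonneg : ∀ w, 0 ≤ φ w
  supp : ∀ w, φ w ≠ 0 → ρ ≤ nrm w ∧ nrm w ≤ R
  hρ : 0 < ρ
  hR : 0 < R

lemma QF.compact {φ : ℝ × ℝ → ℝ} {ρ R : ℝ} (h : QF φ ρ R) : HasCompactSupport φ := by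
  apply HasCompactSupport.intro (K := Set.Icc (-R) R ×ˢ Set.Icc (-R) R) (isCompact_Icc.prod isCompact_Icc)
  intro w hw
  by_contra hn
  apply hw
  obtain ⟨-, h2⟩ := h.supp w hn
  exact ⟨abs_le.1 ((fst_le_nrm w).trans h2), abs_le.1 ((snd_le_nrm w).trans h2)⟩

lemma QF.integrable {φ : ℝ × ℝ → ℝ} {ρ R : ℝ} (h : QF φ ρ R) : Integrable fun w => φ w / nrm w := by
  have e : (fun w => φ w / nrm w) = fun w => φ w * (max (nrm w) ρ)⁻¹ := by
    funext w
    by_cases h0 : φ w = 0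
    · simp [h0]
    · rw [max_eq_left (h.supp w h0).1]; rfl
  rw [e]
  have := h.cont
  have := nrm_cont
  refine Continuous.integrable_of_hasCompactSupport ?_ h.compact.mul_right
  refine h.cont.mul (Continuous.inv₀ (by fun_prop) fun w => ?_)
  exact (lt_max_of_lt_right h.hρ).ne'

def pm (p : ℝ × ℝ) : ℝ × ℝ := p.2 • pl p.1

def pmD (p : ℝ × ℝ) : ℝ × ℝ →L[ℝ] ℝ × ℝ :=
  (Matrix.toLin (.finTwoProd ℝ) (.finTwoProd ℝ)
    !![-p.2, 1 - p.1; p.2, p.1]).toContinuousLinearMap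

lemma pm_deriv (p : ℝ × ℝ) : HasFDerivAt pm (pmD p) p := by
  unfold pmD
  rw [Matrix.toLin_finTwoProd_toContinuousLinearMap]
  have e : pm = fun p : ℝ × ℝ => (p.2 * (1 - p.1), p.2 * p.1) := by
    funext p; simp [pm, pl]
  rw [e]
  have h1 : HasFDerivAt (fun p : ℝ × ℝ => p.2 * (1 - p.1)) _ p :=
    (hasFDerivAt_snd (𝕜 := ℝ) (p := p)).mul ((hasFDerivAt_fst (𝕜 := ℝ) (p := p)).const_sub (1 : ℝ))
  have h2 : HasFDerivAt (fun p : ℝ × ℝ => p.2 * p.1) _ p :=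
    (hasFDerivAt_snd (𝕜 := ℝ) (p := p)).mul (hasFDerivAt_fst (𝕜 := ℝ) (p := p))
  convert! h1.prodMk h2 using 2
  simp [neg_smul _ (ContinuousLinearMap.fst ℝ ℝ ℝ)]

lemma pm_det (p : ℝ × ℝ) : (pmD p).det = -p.2 := by
  unfold pmD
  simp only [LinearMap.det_toContinuousLinearMap, LinearMap.det_toLin, Matrix.det_fin_two_of]
  ring

def QQ : Set (ℝ × ℝ) := Set.Ioi 0 ×ˢ Set.Ioi 0

lemma pm_image : pm '' (Set.Ioo (0:ℝ) 1 ×ˢ Set.Ioi (0:ℝ)) = QQ := by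
  ext w
  constructor
  · rintro ⟨⟨t, z⟩, ⟨⟨h0, h1⟩, hz⟩, rfl⟩
    simp only [Set.mem_Ioi] at hz h0 h1
    have : 0 < 1 - t := by linarith
    constructor <;> simp [pm, pl] <;> positivity
  · rintro ⟨h0, h1⟩
    simp only [Set.mem_Ioi] at h0 h1
    have he : 0 < ell w := by simp only [ell]; linarith
    refine ⟨(lam w, ell w), ⟨⟨?_, ?_⟩, he⟩, pl_lam he⟩
    · simp only [lam]; positivity
    · simp only [lam]; rw [div_lt_one he]; simp only [ell]; linarith

lemma pm_inj : Set.InjOn pm (Set.Ioo (0:ℝ) 1 ×ˢ Set.Ioi (0:ℝ)) := by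
  rintro ⟨t, z⟩ ⟨-, hz⟩ ⟨t', z'⟩ ⟨-, hz'⟩ he
  simp only [Set.mem_Ioi] at hz hz'
  simp only [pm, pl, Prod.smul_mk, smul_eq_mul, Prod.mk.injEq] at he
  have h1 : z = z' := by linarith [he.1, he.2]
  subst h1
  have := mul_left_cancel₀ hz.ne' he.2
  rw [this]

lemma quad_int {φ : ℝ × ℝ → ℝ} {ρ R : ℝ} (h : QF φ ρ R) :
    ∫ w in QQ, φ w / nrm w = ∫ t in (0:ℝ)..1, (∫ z in Set.Ioi (0:ℝ), φ (z • pl t)) / nrm (pl t) := by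
  have hs : MeasurableSet (Set.Ioo (0:ℝ) 1 ×ˢ Set.Ioi (0:ℝ)) := measurableSet_Ioo.prod measurableSet_Ioi
  have hd : ∀ p ∈ (Set.Ioo (0:ℝ) 1 ×ˢ Set.Ioi (0:ℝ)), HasFDerivWithinAt pm (pmD p) (Set.Ioo (0:ℝ) 1 ×ˢ Set.Ioi (0:ℝ)) p :=
    fun p _ => (pm_deriv p).hasFDerivWithinAt
  have hI : IntegrableOn (fun w => φ w / nrm w) (pm '' (Set.Ioo (0:ℝ) 1 ×ˢ Set.Ioi (0:ℝ))) := h.integrable.integrableOn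
  rw [integrableOn_image_iff_integrableOn_abs_det_fderiv_smul _ hs hd pm_inj] at hI
  rw [← pm_image, integral_image_eq_integral_abs_det_fderiv_smul _ hs hd pm_inj]
  have e : ∀ p ∈ (Set.Ioo (0:ℝ) 1 ×ˢ Set.Ioi (0:ℝ)), |(pmD p).det| • (φ (pm p) / nrm (pm p)) = φ (p.2 • pl p.1) / nrm (pl p.1) := by
    rintro ⟨t, z⟩ ⟨-, hz⟩
    simp only [Set.mem_Ioi] at hz
    have := nrm_pl_pos t
    rw [pm_det, abs_neg, abs_of_pos hz]
    simp only [pm, nrm_smul, abs_of_pos hz, smul_eq_mul]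
    field_simp
  rw [setIntegral_congr_fun hs e]
  rw [integrableOn_congr_fun e hs] at hI
  rw [Measure.volume_eq_prod] at hI ⊢
  rw [setIntegral_prod _ hI, intervalIntegral.integral_of_le zero_le_one, integral_Ioc_eq_integral_Ioo]
  simp only [integral_div]

def Psi (φ : ℝ × ℝ → ℝ) (ρ R c δ : ℝ) (p : (ℝ × ℝ) × (ℝ × ℝ)) : ℝ :=
  φ p.1 * plat (ρ / 2) ρ (2 * R) (ell p.1) * plat δ (-1) c (nrm p.2)

lemma ell_cont : Continuous ell := by unfold ell; fun_prop

lemma Psi_TF {φ : ℝ × ℝ → ℝ} {ρ R : ℝ} (h : QF φ ρ R) {c δ : ℝ} (hc : 0 ≤ c) (hδ : 0 < δ) :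
    ∃ M, TF (Psi φ ρ R c δ) (ρ / 2) (2 * R + ρ / 2) (2 * (c + δ)) M := by
  have hρ := h.hρ
  have hR := h.hR
  have hcont := h.cont
  have hell := ell_cont
  have hnrm := nrm_cont
  have hC : Continuous (Psi φ ρ R c δ) := by
    have p1 := plat_cont (ρ / 2) ρ (2 * R)
    have p2 := plat_cont δ (-1) c
    unfold Psi; fun_prop
  have hS : HasCompactSupport (Psi φ ρ R c δ) := by
    apply HasCompactSupport.intro (K := (Set.Icc (-R) R ×ˢ Set.Icc (-R) R) ×ˢ
      (Set.Icc (-(c + δ)) (c + δ) ×ˢ Set.Icc (-(c + δ)) (c + δ)))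
      ((isCompact_Icc.prod isCompact_Icc).prod (isCompact_Icc.prod isCompact_Icc))
    intro p hp
    by_contra hn
    apply hp
    have h2 := (h.supp _ (left_ne_zero_of_mul (left_ne_zero_of_mul hn))).2
    have h3 := (plat_supp hδ (right_ne_zero_of_mul hn)).2
    exact ⟨⟨abs_le.1 ((fst_le_nrm _).trans h2), abs_le.1 ((snd_le_nrm _).trans h2)⟩,
      ⟨abs_le.1 ((fst_le_nrm _).trans h3), abs_le.1 ((snd_le_nrm _).trans h3)⟩⟩
  obtain ⟨M, hM⟩ := hS.exists_bound_of_continuous hC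
  refine ⟨M, hS.uniformContinuous_of_continuous hC, fun p => ?_, fun p => (Real.le_norm_self _).trans (hM p), fun p hn => ?_, by positivity, by positivity, by positivity⟩
  · exact mul_nonneg (mul_nonneg (h.nonneg _) (plat_nonneg _ _ _ _)) (plat_nonneg _ _ _ _)
  · have h1 := plat_supp (by positivity) (right_ne_zero_of_mul (left_ne_zero_of_mul hn))
    have h3 := (plat_supp hδ (right_ne_zero_of_mul hn)).2
    refine ⟨by linarith, h1.2, (ell_le_nrm _).trans (by linarith)⟩

/-- mass of the cut-off -/
def XX (c δ : ℝ) : ℝ := ∫ s : ℝ, plat δ (-1) c |s|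

lemma XX_bd {c δ : ℝ} (hc : 0 ≤ c) (hδ : 0 < δ) : 2 * c ≤ XX c δ ∧ XX c δ ≤ 2 * (c + δ) := by
  have hi : Integrable fun s : ℝ => plat δ (-1) c |s| := by
    refine Continuous.integrable_of_hasCompactSupport ((plat_cont _ _ _).comp continuous_abs) ?_
    apply HasCompactSupport.intro (K := Set.Icc (-(c + δ)) (c + δ)) isCompact_Icc
    intro s hs
    by_contra hn
    exact hs (abs_le.1 (plat_supp hδ hn).2)
  have i1 : ∀ u : ℝ, Integrable ((Set.Icc (-u) u).indicator fun _ => (1:ℝ)) := fun u =>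
    (integrable_indicator_iff measurableSet_Icc).2 (integrableOn_const (by simp) (hC := enorm_ne_top))
  have i2 : ∀ u : ℝ, 0 ≤ u → ∫ s, (Set.Icc (-u) u).indicator (fun _ => (1:ℝ)) s = 2 * u := by
    intro u hu
    rw [integral_indicator measurableSet_Icc]
    simp [Measure.real, hu]
    linarith
  constructor
  · rw [← i2 c hc]
    apply integral_mono (i1 c) hi
    intro s
    apply Set.indicator_le' (fun x hx => ?_) (fun x _ => plat_nonneg _ _ _ _)
    rw [plat_one hδ (by linarith [abs_nonneg x]) (abs_le.2 hx)]
  · rw [← i2 (c + δ) (by positivity)]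
    apply integral_mono hi (i1 (c + δ))
    intro s
    by_cases hs : plat δ (-1) c |s| = 0
    · simp only [hs]
      exact Set.indicator_nonneg (fun _ _ => zero_le_one) _
    · have : s ∈ Set.Icc (-(c + δ)) (c + δ) := abs_le.1 (plat_supp hδ hs).2
      simp only [Set.indicator_of_mem this]
      exact plat_le _ _ _ _

lemma kk_Psi {φ : ℝ × ℝ → ℝ} {ρ R : ℝ} (h : QF φ ρ R) {c δ : ℝ} {t : ℝ} (h0 : 0 ≤ t) (h1 : t ≤ 1) :
    kk (Psi φ ρ R c δ) t = XX c δ * ((∫ z in Set.Ioi (0:ℝ), φ (z • pl t)) / nrm (pl t)) := by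
  have hρ := h.hρ
  have hn := nrm_pl_pos t
  have e1 : ∀ p : ℝ × ℝ, Psi φ ρ R c δ (p.1 • pl t, p.2 • pl t)
      = (Set.Ioi (0:ℝ)).indicator (fun z => φ (z • pl t)) p.1 * (fun s => plat δ (-1) c |s * nrm (pl t)|) p.2 := by
    intro p
    simp only [Psi, nrm_smul, ell_smul, ell_pl, mul_one, abs_mul, abs_of_pos hn]
    congr 1
    by_cases hz : 0 < p.1
    · rw [Set.indicator_of_mem (Set.mem_Ioi.2 hz)]
      by_cases hf : φ (p.1 • pl t) = 0
      · simp [hf]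
      · obtain ⟨l1, l2⟩ := h.supp _ hf
        have q1 : nrm (p.1 • pl t) ≤ ell (p.1 • pl t) := by
          apply nrm_le_ell <;> simp only [pl, Prod.smul_mk, smul_eq_mul]
          · exact mul_nonneg hz.le (by linarith)
          · positivity
        have q2 := (le_abs_self _).trans (ell_le_nrm (p.1 • pl t))
        rw [ell_smul, ell_pl, mul_one] at q1 q2
        rw [plat_one (by positivity) (by linarith) (by linarith), mul_one]
    · rw [Set.indicator_of_notMem (by simpa using hz)]
      by_contra hne
      have := (plat_supp (by positivity) (right_ne_zero_of_mul hne)).1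
      linarith
  unfold kk
  simp only [e1]
  rw [Measure.volume_eq_prod, integral_prod_mul ((Set.Ioi (0:ℝ)).indicator (fun z => φ (z • pl t)))
    (fun s => plat δ (-1) c |s * nrm (pl t)|), integral_indicator measurableSet_Ioi,
    Measure.integral_comp_mul_right (fun s => plat δ (-1) c |s|), abs_of_pos (by positivity)]
  simp only [XX, smul_eq_mul]
  ring

lemma Psi_limit {x y : ℝ} (hI : Irr x y) {φ : ℝ × ℝ → ℝ} {ρ R : ℝ} (h : QF φ ρ R) {c δ : ℝ}
    (hc : 0 ≤ c) (hδ : 0 < δ) :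
    Tendsto (fun T => csum x y (Psi φ ρ R c δ) T (1, 0) (0, 1)) atTop
      (𝓝 (kap / (x ^ 2 + y ^ 2) * (XX c δ * ∫ w in QQ, φ w / nrm w))) := by
  obtain ⟨M, hM⟩ := Psi_TF h hc hδ
  have := std_limit hI hM
  have e : ∫ t in (0:ℝ)..1, kk (Psi φ ρ R c δ) t = XX c δ * ∫ w in QQ, φ w / nrm w := by
    rw [quad_int h, ← intervalIntegral.integral_const_mul]
    apply intervalIntegral.integral_congr
    intro t ht
    rw [Set.uIcc_of_le zero_le_one] at ht
    exact kk_Psi h ht.1 ht.2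
  rwa [e] at this

/-- the pair `γ v` -/
def Wp (x y : ℝ) (γ : SL2Z) : ℝ × ℝ := (zf x y (grow γ 0), zf x y (grow γ 1))
def Sp (x y : ℝ) (γ : SL2Z) : ℝ × ℝ := (sf x y (grow γ 0), sf x y (grow γ 1))

/-- indicator of norm at most `T` -/
def Bd (x y T : ℝ) (γ : SL2Z) : Prop := nrm (Wp x y γ) ^ 2 + nrm (Sp x y γ) ^ 2 ≤ (x ^ 2 + y ^ 2) * T ^ 2

open Classical in
def qterm (x y : ℝ) (φ : ℝ × ℝ → ℝ) (T : ℝ) (γ : SL2Z) : ℝ :=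
  if PosG x y γ ∧ Bd x y T γ then φ (Wp x y γ) else 0

lemma gpt_std (x y T : ℝ) (γ : SL2Z) : gpt x y T (1, 0) (0, 1) γ = (Wp x y γ, T⁻¹ • Sp x y γ) := by
  simp [gpt, Wp, Sp]
  constructor <;> ring

lemma plat_e {φ : ℝ × ℝ → ℝ} {ρ R : ℝ} (h : QF φ ρ R) {x y : ℝ} {γ : SL2Z} (hP : PosG x y γ)
    (hf : φ (Wp x y γ) ≠ 0) : plat (ρ / 2) ρ (2 * R) (ell (Wp x y γ)) = 1 := by
  obtain ⟨l1, l2⟩ := h.supp _ hf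
  have hρ := h.hρ
  have q1 : nrm (Wp x y γ) ≤ ell (Wp x y γ) := nrm_le_ell hP.1.le hP.2.le
  have q2 := (le_abs_self _).trans (ell_le_nrm (Wp x y γ))
  exact plat_one (by positivity) (by linarith) (by linarith)

lemma q_upper {x y : ℝ} (hI : Irr x y) {φ : ℝ × ℝ → ℝ} {ρ R : ℝ} (h : QF φ ρ R) {δ : ℝ} (hδ : 0 < δ)
    {T : ℝ} (hT : 0 < T) (γ : SL2Z) :
    qterm x y φ T γ ≤ cterm x y (Psi φ ρ R (Real.sqrt (x ^ 2 + y ^ 2)) δ) T (1, 0) (0, 1) γ := by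
  have hq := hI.q_pos
  unfold qterm cterm
  by_cases hP : PosG x y γ
  · by_cases hB : Bd x y T γ
    · rw [if_pos ⟨hP, hB⟩, if_pos hP, gpt_std]
      by_cases hf : φ (Wp x y γ) = 0
      · simp [Psi, hf]
      · simp only [Psi, plat_e h hP hf, mul_one]
        rw [plat_one hδ, mul_one]
        · linarith [nrm_nonneg (T⁻¹ • Sp x y γ)]
        · rw [nrm_smul, abs_of_pos (by positivity)]
          apply Real.le_sqrt_of_sq_le
          rw [mul_pow, inv_pow, inv_mul_le_iff₀ (by positivity)]
          have : 0 ≤ nrm (Wp x y γ) ^ 2 := by positivity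
          unfold Bd at hB
          linarith
    · rw [if_neg (fun h => hB h.2), if_pos hP, gpt_std]
      exact mul_nonneg (mul_nonneg (h.nonneg _) (plat_nonneg _ _ _ _)) (plat_nonneg _ _ _ _)
  · rw [if_neg (fun h => hP h.1), if_neg hP]

lemma q_lower {x y : ℝ} {φ : ℝ × ℝ → ℝ} {ρ R : ℝ} (h : QF φ ρ R) {c δ : ℝ} (hδ : 0 < δ)
    (hc : 0 ≤ c) {T : ℝ} (hT : 0 < T) (hTR : R ^ 2 + (c + δ) ^ 2 * T ^ 2 ≤ (x ^ 2 + y ^ 2) * T ^ 2) (γ : SL2Z) :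
    cterm x y (Psi φ ρ R c δ) T (1, 0) (0, 1) γ ≤ qterm x y φ T γ := by
  unfold qterm cterm
  by_cases hP : PosG x y γ
  · rw [if_pos hP, gpt_std]
    by_cases hB : Bd x y T γ
    · rw [if_pos ⟨hP, hB⟩]
      simp only [Psi]
      rw [mul_assoc]
      apply mul_le_of_le_one_right (h.nonneg _)
      exact mul_le_one₀ (plat_le _ _ _ _) (plat_nonneg _ _ _ _) (plat_le _ _ _ _)
    · rw [if_neg (fun h => hB h.2)]
      by_contra hne
      apply hB
      have hne : Psi φ ρ R c δ (Wp x y γ, T⁻¹ • Sp x y γ) ≠ 0 := fun h0 => hne h0.le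
      have l1 := (h.supp _ (left_ne_zero_of_mul (left_ne_zero_of_mul hne))).2
      have l2 := (plat_supp hδ (right_ne_zero_of_mul hne)).2
      simp only at l1 l2
      rw [nrm_smul, abs_of_pos (by positivity), inv_mul_le_iff₀ hT] at l2
      have m1 : nrm (Wp x y γ) ^ 2 ≤ R ^ 2 := pow_le_pow_left₀ (nrm_nonneg _) l1 2
      have m2 : nrm (Sp x y γ) ^ 2 ≤ (T * (c + δ)) ^ 2 := pow_le_pow_left₀ (nrm_nonneg _) l2 2
      unfold Bd
      rw [mul_pow] at m2
      linarith
  · rw [if_neg hP, if_neg (fun h => hP h.1)]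

lemma qterm_nonneg {x y : ℝ} {φ : ℝ × ℝ → ℝ} {ρ R : ℝ} (h : QF φ ρ R) (T : ℝ) (γ : SL2Z) : 0 ≤ qterm x y φ T γ := by
  unfold qterm
  split_ifs
  · exact h.nonneg _
  · exact le_rfl

lemma q_summable {x y : ℝ} (hI : Irr x y) {φ : ℝ × ℝ → ℝ} {ρ R : ℝ} (h : QF φ ρ R) 
    {T : ℝ} (hT : 0 < T) : Summable (qterm x y φ T) := by
  obtain ⟨M, hM⟩ := Psi_TF h (Real.sqrt_nonneg (x ^ 2 + y ^ 2)) one_pos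
  exact Summable.of_nonneg_of_le (qterm_nonneg h T) (q_upper hI h one_pos hT) (cs_summable hI hM hT std_cone)

lemma quad_limit {x y : ℝ} (hI : Irr x y) {φ : ℝ × ℝ → ℝ} {ρ R : ℝ} (h : QF φ ρ R) :
    Tendsto (fun T => (1 / T) * ∑' γ, qterm x y φ T γ) atTop
      (𝓝 (2 * kap / Real.sqrt (x ^ 2 + y ^ 2) * ∫ w in QQ, φ w / nrm w)) := by
  have hq := hI.q_pos
  set s := Real.sqrt (x ^ 2 + y ^ 2) with hs
  have hs0 : 0 < s := Real.sqrt_pos.2 hq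
  have hs2 : s ^ 2 = x ^ 2 + y ^ 2 := Real.sq_sqrt hq.le
  set I := ∫ w in QQ, φ w / nrm w with hId
  have hI0 : 0 ≤ I := integral_nonneg fun w => div_nonneg (h.nonneg _) (nrm_nonneg _)
  have hk := kap_pos
  set C := kap / (x ^ 2 + y ^ 2) * I with hC
  have hC0 : 0 ≤ C := by positivity
  have lim : 2 * kap / s * I = C * (2 * s) := by
    rw [hC, ← hs2]; field_simp
  rw [lim]
  rw [tendsto_order]
  constructor
  · intro a ha
    obtain ⟨δ, hδ, hδs, hδa⟩ : ∃ δ : ℝ, 0 < δ ∧ 2 * δ ≤ s ∧ a < C * (2 * (s - 2 * δ)) := by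
      have t1 : Tendsto (fun δ : ℝ => C * (2 * (s - 2 * δ))) (𝓝[>] 0) (𝓝 (C * (2 * (s - 2 * 0)))) :=
        ((by fun_prop : Continuous fun δ : ℝ => C * (2 * (s - 2 * δ))).tendsto 0).mono_left nhdsWithin_le_nhds
      rw [mul_zero, sub_zero] at t1
      have t2 : ∀ᶠ δ in 𝓝[>] (0:ℝ), δ < s / 2 := nhdsWithin_le_nhds (gt_mem_nhds (by positivity))
      obtain ⟨δ, ⟨d1, d2⟩, d3⟩ := (((t1.eventually (lt_mem_nhds ha)).and t2).and self_mem_nhdsWithin).exists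
      exact ⟨δ, d3, by linarith, d1⟩
    have hc : 0 ≤ s - 2 * δ := by linarith
    obtain ⟨M, hM⟩ := Psi_TF h hc hδ
    have L := Psi_limit hI h hc hδ
    have hlt : a < kap / (x ^ 2 + y ^ 2) * (XX (s - 2 * δ) δ * I) := by
      refine hδa.trans_le ?_
      have : kap / (x ^ 2 + y ^ 2) * (XX (s - 2 * δ) δ * I) = C * XX (s - 2 * δ) δ := by rw [hC]; ring
      rw [this]
      exact mul_le_mul_of_nonneg_left (XX_bd hc hδ).1 hC0
    have ev : ∀ᶠ T : ℝ in atTop, R ^ 2 / (δ * s) ≤ T ^ 2 :=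
      (tendsto_pow_atTop two_ne_zero).eventually_ge_atTop _
    filter_upwards [L.eventually (lt_mem_nhds hlt), eventually_gt_atTop 0, ev] with T h1 hT h2
    refine h1.trans_le ?_
    unfold csum
    refine mul_le_mul_of_nonneg_left ?_ (by positivity)
    refine (cs_summable hI hM hT std_cone).tsum_le_tsum (q_lower h hδ hc hT ?_) (q_summable hI h hT)
    rw [div_le_iff₀ (by positivity)] at h2
    have : (x ^ 2 + y ^ 2) - (s - 2 * δ + δ) ^ 2 ≥ δ * s := by rw [← hs2]; nlinarith
    nlinarith [sq_nonneg T]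
  · intro a ha
    obtain ⟨δ, hδ, hδa⟩ : ∃ δ : ℝ, 0 < δ ∧ C * (2 * (s + δ)) < a := by
      have t1 : Tendsto (fun δ : ℝ => C * (2 * (s + δ))) (𝓝[>] 0) (𝓝 (C * (2 * (s + 0)))) :=
        ((by fun_prop : Continuous fun δ : ℝ => C * (2 * (s + δ))).tendsto 0).mono_left nhdsWithin_le_nhds
      rw [add_zero] at t1
      obtain ⟨δ, d1, d3⟩ := ((t1.eventually (gt_mem_nhds ha)).and self_mem_nhdsWithin).exists
      exact ⟨δ, d3, d1⟩
    obtain ⟨M, hM⟩ := Psi_TF h hs0.le hδ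
    have L := Psi_limit hI h hs0.le hδ
    have hlt : kap / (x ^ 2 + y ^ 2) * (XX s δ * I) < a := by
      refine lt_of_le_of_lt ?_ hδa
      have : kap / (x ^ 2 + y ^ 2) * (XX s δ * I) = C * XX s δ := by rw [hC]; ring
      rw [this]
      exact mul_le_mul_of_nonneg_left (XX_bd hs0.le hδ).2 hC0
    filter_upwards [L.eventually (gt_mem_nhds hlt), eventually_gt_atTop 0] with T h1 hT
    refine lt_of_le_of_lt ?_ h1
    unfold csum
    refine mul_le_mul_of_nonneg_left ?_ (by positivity)
    exact (q_summable hI h hT).tsum_le_tsum (q_upper hI h hδ hT) (cs_summable hI hM hT std_cone)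

def irot (p : ℝ × ℝ) : ℝ × ℝ := (p.2, -p.1)

lemma irot_cont : Continuous irot := by unfold irot; fun_prop
lemma nrm_irot (p : ℝ × ℝ) : nrm (irot p) = nrm p := by
  simp only [nrm, irot]; congr 1; ring

lemma QF.irot {φ : ℝ × ℝ → ℝ} {ρ R : ℝ} (h : QF φ ρ R) : QF (fun p => φ (irot p)) ρ R where
  cont := h.cont.comp irot_cont
  nonneg w := h.nonneg _
  supp w hw := by simpa only [nrm_irot] using h.supp _ hw
  hρ := h.hρ
  hR := h.hR

def irotE : ℝ × ℝ ≃ᵐ ℝ × ℝ where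
  toFun p := (p.2, -p.1)
  invFun p := (-p.2, p.1)
  left_inv p := by simp
  right_inv p := by simp
  measurable_toFun := by simp only [Equiv.coe_fn_mk]; fun_prop
  measurable_invFun := by simp only [Equiv.coe_fn_symm_mk]; fun_prop

lemma irot_mp : MeasurePreserving irotE := by
  have h1 : MeasurePreserving (Prod.swap : ℝ × ℝ → ℝ × ℝ) (volume.prod volume) (volume.prod volume) :=
    Measure.measurePreserving_swap
  have h2 : MeasurePreserving (Prod.map id (fun x : ℝ => -x) : ℝ × ℝ → ℝ × ℝ) (volume.prod volume) (volume.prod volume) :=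
    (MeasurePreserving.id _).prod (Measure.measurePreserving_neg volume)
  exact h2.comp h1

lemma int_irot (g : ℝ × ℝ → ℝ) : ∫ p, g (irot p) = ∫ p, g p := irot_mp.integral_comp' g

lemma QQ_meas : MeasurableSet QQ := measurableSet_Ioi.prod measurableSet_Ioi

lemma off_axes : ∀ᵐ p : ℝ × ℝ, p.1 ≠ 0 ∧ p.2 ≠ 0 := by
  have h1 : ∀ᵐ x : ℝ, x ≠ 0 := Measure.ae_ne volume 0
  rw [Measure.volume_eq_prod]
  exact (Measure.quasiMeasurePreserving_fst.ae h1).and (Measure.quasiMeasurePreserving_snd.ae h1)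

lemma ind_sum {p : ℝ × ℝ} (h0 : p.1 ≠ 0) (h1 : p.2 ≠ 0) (u : ℝ) : 
    QQ.indicator (fun _ => u) p + QQ.indicator (fun _ => u) (irot p)
     + QQ.indicator (fun _ => u) (irot (irot p)) + QQ.indicator (fun _ => u) (irot (irot (irot p))) = u := by
  obtain ⟨a, b⟩ := p
  simp only at h0 h1
  simp only [Set.indicator, QQ, irot, Set.mem_prod, Set.mem_Ioi]
  rcases lt_or_gt_of_ne h0 with h0 | h0 <;> rcases lt_or_gt_of_ne h1 with h1 | h1 <;>
    simp [h0, h1, h0.not_gt, h1.not_gt]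

lemma irot4 (p : ℝ × ℝ) : irot (irot (irot (irot p))) = p := by simp [irot]

lemma int_four {φ : ℝ × ℝ → ℝ} {ρ R : ℝ} (h : QF φ ρ R) :
    (∫ w in QQ, φ w / nrm w) + (∫ w in QQ, φ (irot w) / nrm w) + (∫ w in QQ, φ (irot (irot w)) / nrm w)
      + (∫ w in QQ, φ (irot (irot (irot w))) / nrm w) = ∫ w, φ w / nrm w := by
  set g : ℝ × ℝ → ℝ := fun w => φ w / nrm w with hg
  have e1 : ∀ w, φ (irot w) / nrm w = g (irot w) := fun w => by simp only [hg, nrm_irot]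
  have e2 : ∀ w, φ (irot (irot w)) / nrm w = g (irot (irot w)) := fun w => by simp only [hg, nrm_irot]
  have e3 : ∀ w, φ (irot (irot (irot w))) / nrm w = g (irot (irot (irot w))) := fun w => by simp only [hg, nrm_irot]
  have hgi : Integrable g := h.integrable
  simp only [e1, e2, e3]
  rw [← integral_indicator QQ_meas, ← integral_indicator QQ_meas, ← integral_indicator QQ_meas,
    ← integral_indicator QQ_meas]
  have f1 : (∫ w, QQ.indicator (fun w => g (irot w)) w) = ∫ w, QQ.indicator (fun _ => g w) (irot (irot (irot w))) := by
    rw [← int_irot, ← int_irot, ← int_irot]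
    simp only [Set.indicator, irot4]
  have f2 : (∫ w, QQ.indicator (fun w => g (irot (irot w))) w) = ∫ w, QQ.indicator (fun _ => g w) (irot (irot w)) := by
    rw [← int_irot, ← int_irot]
    simp only [Set.indicator, irot4]
  have f3 : (∫ w, QQ.indicator (fun w => g (irot (irot (irot w)))) w) = ∫ w, QQ.indicator (fun _ => g w) (irot w) := by
    rw [← int_irot]
    simp only [Set.indicator, irot4]
  rw [f1, f2, f3]
  have hm : Measurable irot := irot_cont.measurable
  have ii : ∀ k : ℝ × ℝ → ℝ × ℝ, Measurable k → Integrable fun w => QQ.indicator (fun _ => g w) (k w) := by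
    intro k hk
    have : (fun w => QQ.indicator (fun _ => g w) (k w)) = (k ⁻¹' QQ).indicator g := by
      funext w; rfl
    rw [this]
    exact hgi.indicator (hk QQ_meas)
  have i0 := ii id measurable_id
  have i1 := ii irot hm
  have i2 := ii (fun w => irot (irot w)) (hm.comp hm)
  have i3 := ii (fun w => irot (irot (irot w))) (hm.comp (hm.comp hm))
  have e0 : (∫ w, QQ.indicator (fun w => g w) w) = ∫ w, QQ.indicator (fun _ => g w) (id w) := by
    simp only [Set.indicator, id]
  rw [e0]
  have s1 := integral_add (i0.add (i1.add i2)) i3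
  have s2 := integral_add i0 (i1.add i2)
  have s3 := integral_add i1 i2
  simp only [Pi.add_apply] at s1 s2 s3
  have s4 : (∫ w, g w) = ∫ w, (QQ.indicator (fun _ => g w) (id w) + (QQ.indicator (fun _ => g w) (irot w)
     + QQ.indicator (fun _ => g w) (irot (irot w))) + QQ.indicator (fun _ => g w) (irot (irot (irot w)))) := by
    apply integral_congr_ae
    filter_upwards [off_axes] with w hw
    have := ind_sum hw.1 hw.2 (g w)
    simp only [id]
    linarith
  rw [s4, s1, s2, s3]
  ring

def Jm : SL2Z := ⟨!![0, 1; -1, 0], by simp [Matrix.det_fin_two_of]⟩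

lemma Jm_W (x y : ℝ) (γ : SL2Z) : Wp x y (Jm * γ) = irot (Wp x y γ) := by
  simp only [Wp, irot, zf_row_mul]
  simp [Jm]
lemma Jm_S (x y : ℝ) (γ : SL2Z) : Sp x y (Jm * γ) = irot (Sp x y γ) := by
  simp only [Sp, irot, sf_row_mul]
  simp [Jm]
lemma Jm_Bd (x y T : ℝ) (γ : SL2Z) : Bd x y T (Jm * γ) ↔ Bd x y T γ := by
  simp only [Bd, Jm_W, Jm_S, nrm_irot]

open Classical in
def fterm (x y : ℝ) (φ : ℝ × ℝ → ℝ) (T : ℝ) (γ : SL2Z) : ℝ :=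
  if Bd x y T γ then φ (Wp x y γ) else 0

lemma qterm_ind (x y : ℝ) (φ : ℝ × ℝ → ℝ) (T : ℝ) (γ : SL2Z) :
    qterm x y φ T γ = QQ.indicator (fun _ => fterm x y φ T γ) (Wp x y γ) := by
  unfold qterm fterm
  by_cases hP : PosG x y γ
  · rw [Set.indicator_of_mem (show Wp x y γ ∈ QQ from hP)]
    by_cases hB : Bd x y T γ
    · rw [if_pos ⟨hP, hB⟩, if_pos hB]
    · rw [if_neg (fun h => hB h.2), if_neg hB]
  · rw [Set.indicator_of_notMem (show Wp x y γ ∉ QQ from hP)]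
    exact if_neg (fun h => hP h.1)

lemma fterm_J (x y : ℝ) (φ : ℝ × ℝ → ℝ) (T : ℝ) (γ : SL2Z) :
    fterm x y φ T (Jm * γ) = fterm x y (fun p => φ (irot p)) T γ := by
  unfold fterm
  rw [Jm_W]
  by_cases hB : Bd x y T γ
  · rw [if_pos hB, if_pos ((Jm_Bd x y T γ).2 hB)]
  · rw [if_neg hB, if_neg (fun h => hB ((Jm_Bd x y T γ).1 h))]

lemma grow_ne (γ : SL2Z) (i : Fin 2) : grow γ i ≠ 0 := by
  intro h0
  have := row_det γ
  fin_cases i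
  · change grow γ 0 = 0 at h0
    rw [h0] at this; simp at this
  · change grow γ 1 = 0 at h0
    rw [h0] at this; simp at this

lemma fterm_split {x y : ℝ} (hI : Irr x y) (φ : ℝ × ℝ → ℝ) (T : ℝ) (γ : SL2Z) :
    fterm x y φ T γ = qterm x y φ T γ + qterm x y (fun p => φ (irot (irot (irot p)))) T (Jm * γ)
      + qterm x y (fun p => φ (irot (irot p))) T (Jm * (Jm * γ))
      + qterm x y (fun p => φ (irot p)) T (Jm * (Jm * (Jm * γ))) := by
  simp only [qterm_ind, Jm_W, fterm_J, irot4]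
  exact (ind_sum (zf_ne hI (grow_ne γ 0)) (zf_ne hI (grow_ne γ 1)) _).symm

lemma f_summable {x y : ℝ} (hI : Irr x y) {φ : ℝ × ℝ → ℝ} {ρ R : ℝ} (h : QF φ ρ R)
    {T : ℝ} (hT : 0 < T) : Summable (fterm x y φ T) := by
  have s0 := q_summable hI h hT
  have s1 := summable_mulLeft Jm (q_summable hI h.irot.irot.irot hT)
  have s2 := summable_mulLeft Jm (summable_mulLeft Jm (q_summable hI h.irot.irot hT))
  have s3 := summable_mulLeft Jm (summable_mulLeft Jm (summable_mulLeft Jm (q_summable hI h.irot hT)))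
  exact (((s0.add s1).add s2).add s3).congr fun γ => (fterm_split hI φ T γ).symm

lemma f_tsum {x y : ℝ} (hI : Irr x y) {φ : ℝ × ℝ → ℝ} {ρ R : ℝ} (h : QF φ ρ R)
    {T : ℝ} (hT : 0 < T) : ∑' γ, fterm x y φ T γ = (∑' γ, qterm x y φ T γ)
      + (∑' γ, qterm x y (fun p => φ (irot (irot (irot p)))) T γ)
      + (∑' γ, qterm x y (fun p => φ (irot (irot p))) T γ)
      + (∑' γ, qterm x y (fun p => φ (irot p)) T γ) := by
  have s0 := q_summable hI h hT
  have s1 := summable_mulLeft Jm (q_summable hI h.irot.irot.irot hT)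
  have s2 := summable_mulLeft Jm (summable_mulLeft Jm (q_summable hI h.irot.irot hT))
  have s3 := summable_mulLeft Jm (summable_mulLeft Jm (summable_mulLeft Jm (q_summable hI h.irot hT)))
  rw [tsum_congr (fterm_split hI φ T), ((s0.add s1).add s2).tsum_add s3, (s0.add s1).tsum_add s2,
    s0.tsum_add s1]
  congr 1
  · congr 1
    · congr 1
      exact tsum_mulLeft Jm _
    · rw [tsum_mulLeft Jm (fun γ => qterm x y (fun p => φ (irot (irot p))) T (Jm * γ)), tsum_mulLeft Jm]
  · rw [tsum_mulLeft Jm (fun γ => qterm x y (fun p => φ (irot p)) T (Jm * (Jm * γ))),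
      tsum_mulLeft Jm (fun γ => qterm x y (fun p => φ (irot p)) T (Jm * γ)), tsum_mulLeft Jm]

lemma full_limit {x y : ℝ} (hI : Irr x y) {φ : ℝ × ℝ → ℝ} {ρ R : ℝ} (h : QF φ ρ R) :
    Tendsto (fun T => (1 / T) * ∑' γ, fterm x y φ T γ) atTop
      (𝓝 (2 * kap / Real.sqrt (x ^ 2 + y ^ 2) * ∫ w, φ w / nrm w)) := by
  have l := (((quad_limit hI h).add (quad_limit hI h.irot.irot.irot)).add (quad_limit hI h.irot.irot)).add
    (quad_limit hI h.irot)
  rw [← int_four h]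
  refine (l.congr' ?_).trans_eq ?_
  · filter_upwards [eventually_gt_atTop 0] with T hT
    rw [f_tsum hI h hT]; ring
  · congr 1; ring

def vp (p : ℝ × ℝ) : E2 := vec p.1 p.2

lemma vp_zero (p : ℝ × ℝ) : vp p 0 = p.1 := by simp [vp, _root_.vec]
lemma vp_one (p : ℝ × ℝ) : vp p 1 = p.2 := by simp [vp, _root_.vec]

lemma vp_cont : Continuous vp := by
  have : vp = fun p : ℝ × ℝ => WithLp.toLp 2 ![p.1, p.2] := rfl
  rw [this]
  apply (PiLp.continuous_toLp 2 _).comp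
  apply continuous_pi
  intro i
  fin_cases i <;> simp <;> fun_prop

lemma norm_E2 (v : E2) : ‖v‖ = nrm (v 0, v 1) := by
  rw [EuclideanSpace.norm_eq, nrm]
  simp [Fin.sum_univ_two]

lemma norm_vp (p : ℝ × ℝ) : ‖vp p‖ = nrm p := by rw [norm_E2, vp_zero, vp_one]

lemma act_eq (γ : SL2Z) (v : E2) : act γ v = vp (Wp (v 0) (v 1) γ) := by
  ext i
  fin_cases i <;> simp [act, vp, _root_.vec, Wp, zf, grow, toR, Matrix.mulVec, dotProduct, Fin.sum_univ_two]

lemma int_vp (g : E2 → ℝ) : ∫ w in ({0} : Set E2)ᶜ, g w = ∫ p, g (vp p) := by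
  rw [restrict_compl_singleton]
  have h1 := (PiLp.volume_preserving_toLp (Fin 2))
  have h2 := (volume_preserving_finTwoArrow ℝ).symm
  have h3 := h1.comp h2
  symm
  refine h3.integral_comp ?_ g
  exact (MeasurableEquiv.toLp 2 (Fin 2 → ℝ)).measurableEmbedding.comp (MeasurableEquiv.finTwoArrow).symm.measurableEmbedding

lemma Bd_iff {v : E2} (hI : Irr (v 0) (v 1)) {T : ℝ} (hT : 0 < T) (γ : SL2Z) :
    frobNorm (toR γ) ≤ T ↔ Bd (v 0) (v 1) T γ := by
  have hq := hI.q_pos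
  unfold frobNorm Bd
  rw [Real.sqrt_le_left hT.le, nrm_sq, nrm_sq]
  have e : (Wp (v 0) (v 1) γ).1 ^ 2 + (Wp (v 0) (v 1) γ).2 ^ 2 + ((Sp (v 0) (v 1) γ).1 ^ 2 + (Sp (v 0) (v 1) γ).2 ^ 2)
      = ((v 0) ^ 2 + (v 1) ^ 2) * ∑ i, ∑ j, (toR γ i j) ^ 2 := by
    simp [Wp, Sp, zf, sf, grow, toR, Fin.sum_univ_two]
    ring
  rw [e, mul_le_mul_iff_right₀ hq]

lemma frob_finite (T : ℝ) : {γ : SL2Z | frobNorm (toR γ) ≤ T}.Finite := by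
  have hf : (Set.Icc (-⌈|T|⌉) ⌈|T|⌉).Finite := Set.finite_Icc _ _
  refine Set.Finite.of_finite_image (f := fun γ : SL2Z => (grow γ 0, grow γ 1))
    (((hf.prod hf).prod (hf.prod hf)).subset ?_) ?_
  · rintro _ ⟨γ, hγ, rfl⟩
    simp only [Set.mem_ofPred_eq] at hγ
    have key : ∀ i j, (γ i j) ∈ Set.Icc (-⌈|T|⌉) ⌈|T|⌉ := by
      intro i j
      have h1 : |((γ i j : ℤ) : ℝ)| ≤ frobNorm (toR γ) := by
        apply Real.abs_le_sqrt
        have e : ((γ i j : ℤ) : ℝ) ^ 2 = (toR γ i j) ^ 2 := by simp [toR]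
        rw [e]
        calc (toR γ i j) ^ 2 ≤ ∑ j, (toR γ i j) ^ 2 :=
              Finset.single_le_sum (f := fun j => (toR γ i j) ^ 2) (fun _ _ => sq_nonneg _) (Finset.mem_univ j)
          _ ≤ _ := Finset.single_le_sum (f := fun i => ∑ j, (toR γ i j) ^ 2)
              (fun _ _ => Finset.sum_nonneg fun _ _ => sq_nonneg _) (Finset.mem_univ i)
      have h2 : |((γ i j : ℤ) : ℝ)| ≤ (⌈|T|⌉ : ℤ) := (h1.trans hγ).trans ((le_abs_self T).trans (Int.le_ceil _))
      have h3 : |γ i j| ≤ ⌈|T|⌉ := by exact_mod_cast h2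
      exact abs_le.1 h3
    exact ⟨⟨key 0 0, key 0 1⟩, ⟨key 1 0, key 1 1⟩⟩
  · intro γ _ γ' _ he
    simp only [Prod.mk.injEq] at he
    exact row_ext he.1 he.2

lemma sum_conv {v : E2} (hI : Irr (v 0) (v 1)) {T : ℝ} (hT : 0 < T) (φ : E2 → ℝ) :
    ∑ᶠ γ ∈ {γ : SL2Z | frobNorm (toR γ) ≤ T}, φ (act γ v) = ∑' γ, fterm (v 0) (v 1) (fun p => φ (vp p)) T γ := by
  have e : ∀ γ, fterm (v 0) (v 1) (fun p => φ (vp p)) T γ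
      = {γ : SL2Z | frobNorm (toR γ) ≤ T}.indicator (fun γ => φ (act γ v)) γ := by
    intro γ
    unfold fterm
    by_cases hB : Bd (v 0) (v 1) T γ
    · rw [if_pos hB, Set.indicator_of_mem (show γ ∈ {γ : SL2Z | frobNorm (toR γ) ≤ T} from (Bd_iff hI hT γ).2 hB), act_eq]
    · rw [if_neg hB, Set.indicator_of_notMem (show γ ∉ {γ : SL2Z | frobNorm (toR γ) ≤ T} from fun h => hB ((Bd_iff hI hT γ).1 h))]
  rw [tsum_congr e, finsum_mem_def, tsum_eq_finsum]
  exact (frob_finite T).subset Set.support_indicator_subset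

/-- non-discrete orbits come from irrational directions -/
lemma irr_of_nondiscrete {v : E2} (hv : v ≠ 0)
    (h : ¬ DiscreteTopology ({w : E2 | ∃ γ : SL2Z, w = act γ v})) : Irr (v 0) (v 1) := by
  intro a b hab
  by_contra hne
  apply h
  obtain ⟨t, ht, m, n, h0, h1⟩ : ∃ t : ℝ, t ≠ 0 ∧ ∃ m n : ℤ, v 0 = t * m ∧ v 1 = t * n := by
    have nz : v 0 ≠ 0 ∨ v 1 ≠ 0 := by
      by_contra hn
      push Not at hn
      apply hv
      ext i
      fin_cases i
      · exact hn.1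
      · exact hn.2
    by_cases hb : b = 0
    · have ha : a ≠ 0 := fun ha => hne ⟨ha, hb⟩
      have haR : (a : ℝ) ≠ 0 := by exact_mod_cast ha
      subst hb
      have v0 : v 0 = 0 := by simpa [haR] using hab
      refine ⟨v 1, by simpa [v0] using nz, 0, 1, by simp [v0], by simp⟩
    · have hbR : (b : ℝ) ≠ 0 := by exact_mod_cast hb
      have v1 : v 1 = v 0 / b * (-a : ℤ) := by
        push_cast; field_simp; linarith
      refine ⟨v 0 / b, ?_, b, -a, by field_simp, v1⟩
      rcases nz with h | h
      · exact div_ne_zero h hbR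
      · intro h0
        rw [h0, zero_mul] at v1
        exact h v1
  have hlat : ∀ γ : SL2Z, ∃ i j : ℤ, (act γ v) 0 = t * i ∧ (act γ v) 1 = t * j := by
    intro γ
    rw [act_eq, vp_zero, vp_one]
    refine ⟨γ 0 0 * m + γ 0 1 * n, γ 1 0 * m + γ 1 1 * n, ?_, ?_⟩ <;>
    · simp only [Wp, zf, grow, h0, h1]
      push_cast; ring
  rw [discreteTopology_subtype_iff]
  rintro w ⟨γ, rfl⟩
  obtain ⟨i, j, w0, w1⟩ := hlat γ
  rw [← disjoint_iff, disjoint_principal_right]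
  apply mem_nhdsWithin.2
  refine ⟨Metric.ball (act γ v) |t|, Metric.isOpen_ball, Metric.mem_ball_self (abs_pos.2 ht), ?_⟩
  rintro w' ⟨hb, hne'⟩ ⟨γ', rfl⟩
  obtain ⟨i', j', w0', w1'⟩ := hlat γ'
  apply hne'
  rw [Metric.mem_ball, dist_eq_norm, norm_E2] at hb
  have small : ∀ k l : ℤ, |t * k - t * l| < |t| → k = l := by
    intro k l hkl
    rw [← mul_sub, abs_mul] at hkl
    have h5 : |(k : ℝ) - l| < 1 := by
      by_contra hc
      push Not at hc
      nlinarith [abs_pos.2 ht]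
    have h6 : |k - l| < 1 := by exact_mod_cast h5
    have := Int.abs_lt_one_iff.1 h6
    omega
  have c0 := (fst_le_nrm _).trans_lt hb
  have c1 := (snd_le_nrm _).trans_lt hb
  simp only [PiLp.sub_apply, w0, w1, w0', w1'] at c0 c1
  have ei := small _ _ c0
  have ej := small _ _ c1
  subst ei ej
  change act γ' v = act γ v
  ext k
  fin_cases k
  · exact w0'.trans w0.symm
  · exact w1'.trans w1.symm

lemma QF_of {φ : E2 → ℝ} (hc : Continuous φ) (hs : HasCompactSupport φ) (h0 : tsupport φ ⊆ ({0} : Set E2)ᶜ) :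
    ∃ ρ R : ℝ, 0 < ρ ∧ 0 < R ∧ ∀ p : ℝ × ℝ, φ (vp p) ≠ 0 → ρ ≤ nrm p ∧ nrm p ≤ R := by
  have hs' : IsCompact (tsupport φ) := hs
  obtain ⟨R, hR⟩ := hs'.isBounded.exists_norm_le
  have hnb : (tsupport φ)ᶜ ∈ 𝓝 (0 : E2) := (isClosed_tsupport φ).isOpen_compl.mem_nhds fun h => h0 h rfl
  obtain ⟨ρ, hρ, hb⟩ := Metric.mem_nhds_iff.1 hnb
  refine ⟨ρ, |R| + 1, hρ, by positivity, fun p hp => ?_⟩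
  have hm : vp p ∈ tsupport φ := subset_tsupport φ hp
  rw [← norm_vp]
  constructor
  · by_contra hlt
    push Not at hlt
    exact hb (by simpa using hlt) hm
  · linarith [hR _ hm, le_abs_self R]

/-- Ledrappier–Nogueira equidistribution theorem for the lattice `SL(2,ℤ)`:
there is a constant `c > 0` such that for any nonzero `v ∈ ℝ²` with non-discrete
`SL(2,ℤ)`-orbit and any continuous compactly supported `φ : ℝ² \ {0} → ℝ`,
`(1/T) ∑_{‖γ‖ ≤ T} φ(γ v) → (1/(c |v|)) ∫ φ(w)/|w| dw`. -/
theorem ledrappier_nogueira_SL2Z :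
    ∃ c : ℝ, 0 < c ∧
      ∀ v : E2, v ≠ 0 →
        ¬ DiscreteTopology ({w : E2 | ∃ γ : SL2Z, w = act γ v}) →
        ∀ φ : E2 → ℝ, Continuous φ → HasCompactSupport φ →
          tsupport φ ⊆ ({0} : Set E2)ᶜ →
          Tendsto
            (fun T : ℝ => (1 / T) * ∑ᶠ γ ∈ {γ : SL2Z | frobNorm (toR γ) ≤ T}, φ (act γ v))
            atTop
            (𝓝 ((1 / (c * ‖v‖)) * ∫ w in ({0} : Set E2)ᶜ, φ w / ‖w‖)) := by
  have hk := kap_pos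
  refine ⟨1 / (2 * kap), by positivity, ?_⟩
  intro v hv hd φ hc hs h0
  have hI := irr_of_nondiscrete hv hd
  obtain ⟨ρ, R, hρ, hR, hsupp⟩ := QF_of hc hs h0
  have hcv : Continuous fun p => φ (vp p) := hc.comp vp_cont
  have q1 : QF (fun p => max (φ (vp p)) 0) ρ R :=
    ⟨hcv.max continuous_const, fun _ => le_max_right _ _, fun p hp => hsupp p fun h => hp (by simp [h]), hρ, hR⟩
  have q2 : QF (fun p => max (-φ (vp p)) 0) ρ R :=
    ⟨hcv.neg.max continuous_const, fun _ => le_max_right _ _, fun p hp => hsupp p fun h => hp (by simp [h]), hρ, hR⟩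
  have dec : ∀ u : ℝ, u = max u 0 - max (-u) 0 := by
    intro u
    rcases le_total u 0 with h | h
    · rw [max_eq_right h, max_eq_left (by linarith)]; ring
    · rw [max_eq_left h, max_eq_right (by linarith)]; ring
  have l := (full_limit hI q1).sub (full_limit hI q2)
  have e : 1 / (1 / (2 * kap) * ‖v‖) * ∫ w in ({0} : Set E2)ᶜ, φ w / ‖w‖
      = 2 * kap / Real.sqrt ((v 0) ^ 2 + (v 1) ^ 2) * (∫ w, max (φ (vp w)) 0 / nrm w)
        - 2 * kap / Real.sqrt ((v 0) ^ 2 + (v 1) ^ 2) * ∫ w, max (-φ (vp w)) 0 / nrm w := by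
    rw [← mul_sub, ← integral_sub q1.integrable q2.integrable, int_vp, norm_E2]
    congr 1
    · simp only [nrm]; field_simp
    · congr 1
      funext p
      rw [norm_vp, ← sub_div, ← dec]
  rw [e]
  refine l.congr' ((eventually_gt_atTop 0).mono fun T hT => ?_)
  beta_reduce
  rw [sum_conv hI hT, ← mul_sub, ← (f_summable hI q1 hT).tsum_sub (f_summable hI q2 hT)]
  congr 1
  apply tsum_congr
  intro γ
  unfold fterm
  split_ifs
  · exact (dec _).symm
  · simp
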